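/- arXiv:0903.2779 — 2 statements merged into one kernel-verified Lean document; each statement's English description precedes it below -/
import Mathlib

section
/- For a coherent commutative ring R, the Gorenstein weak dimension of R equals the supremum of the Gorenstein projective dimensions of finitely presented R-modules. -/
open CategoryTheory

noncomputable section

namespace GW

variable (R : Type) [CommRing R]

/-- `M` is a Gorenstein projective module: there is a doubly infinite exact sequence of
projective modules, remaining exact under `Hom(-, Q)` for every projective `Q`, with `M`
isomorphic to one of its kernels (equivalently, images). -/
def IsGProj (M : ModuleCat.{0} R) : Prop :=
  ∃ (P : ℤ → ModuleCat.{0} R) (d : ∀ i, P i →ₗ[R] P (i + 1)),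
    (∀ i, Module.Projective R (P i)) ∧
    (∀ i, Function.Exact (d i) (d (i + 1))) ∧
    (∀ (Q : ModuleCat.{0} R), Module.Projective R Q →
      ∀ i, Function.Exact
        (fun g : P (i + 1 + 1) →ₗ[R] Q => g.comp (d (i + 1)))
        (fun g : P (i + 1) →ₗ[R] Q => g.comp (d i))) ∧
    Nonempty (M ≃ₗ[R] LinearMap.ker (d 0))

/-- `M` is a strongly Gorenstein projective module. -/
def IsSGProj (M : ModuleCat.{0} R) : Prop :=
  ∃ (P : ModuleCat.{0} R) (f : P →ₗ[R] P),
    Module.Projective R P ∧ Function.Exact f f ∧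
    (∀ (Q : ModuleCat.{0} R), Module.Projective R Q →
      Function.Exact (fun g : P →ₗ[R] Q => g.comp f) (fun g : P →ₗ[R] Q => g.comp f)) ∧
    Nonempty (M ≃ₗ[R] LinearMap.range f)

/-- Gorenstein projective dimension at most `n`, via resolutions by Gorenstein projectives. -/
def gpdLE : ℕ → ModuleCat.{0} R → Prop
  | 0, M => IsGProj R M
  | (n + 1), M => ∃ (K G : ModuleCat.{0} R) (f : K →ₗ[R] G) (g : G →ₗ[R] M),
      IsGProj R G ∧ Function.Injective f ∧ Function.Surjective g ∧
      Function.Exact f g ∧ gpdLE n K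

/-- Gorenstein projective dimension, valued in `ℕ∞`. -/
def gpd (M : ModuleCat.{0} R) : ℕ∞ := ⨅ (n : ℕ) (_ : gpdLE R n M), (n : ℕ∞)

/-- `M` is a Gorenstein flat module. -/
def IsGFlat (M : ModuleCat.{0} R) : Prop :=
  ∃ (F : ℤ → ModuleCat.{0} R) (d : ∀ i, F i →ₗ[R] F (i + 1)),
    (∀ i, Module.Flat R (F i)) ∧
    (∀ i, Function.Exact (d i) (d (i + 1))) ∧
    (∀ (I : ModuleCat.{0} R), Module.Injective R I →
      ∀ i, Function.Exact (LinearMap.lTensor I (d i)) (LinearMap.lTensor I (d (i + 1)))) ∧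
    Nonempty (M ≃ₗ[R] LinearMap.ker (d 0))

/-- Gorenstein flat dimension at most `n`. -/
def gfdLE : ℕ → ModuleCat.{0} R → Prop
  | 0, M => IsGFlat R M
  | (n + 1), M => ∃ (K G : ModuleCat.{0} R) (f : K →ₗ[R] G) (g : G →ₗ[R] M),
      IsGFlat R G ∧ Function.Injective f ∧ Function.Surjective g ∧
      Function.Exact f g ∧ gfdLE n K

/-- Gorenstein flat dimension, valued in `ℕ∞`. -/
def gfd (M : ModuleCat.{0} R) : ℕ∞ := ⨅ (n : ℕ) (_ : gfdLE R n M), (n : ℕ∞)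

/-- The Gorenstein weak dimension of `R`: the supremum of Gorenstein flat dimensions. -/
def gwdim : ℕ∞ := ⨆ M : ModuleCat.{0} R, gfd R M

/-- Projective dimension at most `n`. -/
def pdLE : ℕ → ModuleCat.{0} R → Prop
  | 0, M => Module.Projective R M
  | (n + 1), M => ∃ (K G : ModuleCat.{0} R) (f : K →ₗ[R] G) (g : G →ₗ[R] M),
      Module.Projective R G ∧ Function.Injective f ∧ Function.Surjective g ∧
      Function.Exact f g ∧ pdLE n K

/-- Projective dimension, valued in `ℕ∞`. -/
def pd (M : ModuleCat.{0} R) : ℕ∞ := ⨅ (n : ℕ) (_ : pdLE R n M), (n : ℕ∞)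

/-- Flat dimension at most `n`. -/
def fdLE : ℕ → ModuleCat.{0} R → Prop
  | 0, M => Module.Flat R M
  | (n + 1), M => ∃ (K G : ModuleCat.{0} R) (f : K →ₗ[R] G) (g : G →ₗ[R] M),
      Module.Flat R G ∧ Function.Injective f ∧ Function.Surjective g ∧
      Function.Exact f g ∧ fdLE n K

/-- Flat dimension, valued in `ℕ∞`. -/
def fd (M : ModuleCat.{0} R) : ℕ∞ := ⨅ (n : ℕ) (_ : fdLE R n M), (n : ℕ∞)

/-- A coherent ring: every finitely generated ideal is finitely presented. -/
def IsCoherentRing : Prop := ∀ I : Ideal R, I.FG → Module.FinitePresentation R I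

/-- `Ext^n_R(M, N)` as a module. -/
def extGrp (n : ℕ) (M N : ModuleCat.{0} R) : ModuleCat R :=
  ((Ext R (ModuleCat.{0} R) n).obj (Opposite.op M)).obj N

/-- `Tor_n^R(M, N)`. -/
def torGrp (n : ℕ) (M N : ModuleCat.{0} R) : ModuleCat.{0} R :=
  ((Tor (ModuleCat.{0} R) n).obj M).obj N

/-- The Gorenstein global dimension of `R` (the common value of the suprema of Gorenstein
projective and Gorenstein injective dimensions), here the supremum of `Gpd`. -/
def ggldim : ℕ∞ := ⨆ M : ModuleCat.{0} R, gpd R M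

/-- `M` admits a finite resolution of length `n` by finitely generated projective modules. -/
def finFGRes : ℕ → ModuleCat.{0} R → Prop
  | 0, M => Module.Projective R M ∧ Module.Finite R M
  | (n + 1), M => ∃ (K G : ModuleCat.{0} R) (f : K →ₗ[R] G) (g : G →ₗ[R] M),
      Module.Projective R G ∧ Module.Finite R G ∧ Function.Injective f ∧
      Function.Surjective g ∧ Function.Exact f g ∧ finFGRes n K

/-- The small finitistic projective dimension of `R`. -/
def fPD : ℕ∞ :=
  ⨆ (M : ModuleCat.{0} R) (_ : (∃ n, finFGRes R n M) ∧ pd R M ≠ ⊤), pd R M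

/-- The small finitistic Gorenstein projective dimension of `R`. -/
def fGPD : ℕ∞ :=
  ⨆ (M : ModuleCat.{0} R) (_ : (∃ n, finFGRes R n M) ∧ gpd R M ≠ ⊤), gpd R M

/-- An arithmetical ring: every finitely generated ideal is locally principal. -/
def IsArithmetical : Prop :=
  ∀ I : Ideal R, I.FG → ∀ (p : Ideal R) (hp : p.IsMaximal),
    haveI := hp.isPrime
    (I.map (algebraMap R (Localization.AtPrime p))).IsPrincipal

/-- A quasi-Frobenius ring: Noetherian and self-injective. -/
def IsQuasiFrobenius : Prop := IsNoetherianRing R ∧ Module.Injective R R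

/-- The submodule `X • N` of a module `N` over a power series ring. -/
def Xsub {R : Type} [CommRing R] (N : ModuleCat.{0} (PowerSeries R)) :
    Submodule (PowerSeries R) N :=
  LinearMap.range (LinearMap.lsmul (PowerSeries R) N PowerSeries.X)

lemma Xsub_le {R : Type} [CommRing R] {N N' : ModuleCat.{0} (PowerSeries R)}
    (f : N →ₗ[PowerSeries R] N') : Xsub N ≤ (Xsub N').comap f := by
  rintro x ⟨k, rfl⟩
  exact ⟨f k, (map_smul f _ _).symm⟩

/-- The induced map `N/XN → N'/XN'`. -/
def qmap {R : Type} [CommRing R] {N N' : ModuleCat.{0} (PowerSeries R)}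
    (f : N →ₗ[PowerSeries R] N') :
    (N ⧸ Xsub N) →ₗ[PowerSeries R] (N' ⧸ Xsub N') :=
  Submodule.mapQ _ _ f (Xsub_le f)

end GW

namespace GW

section extbasics

variable (R : Type) [CommRing R]

/-- vanishing of `Ext^n(A, N)`. -/
def EV (n : ℕ) (A N : Type) [AddCommGroup A] [Module R A] [AddCommGroup N] [Module R N] : Prop :=
  Subsingleton (Abelian.Ext.{0} (ModuleCat.of R A) (ModuleCat.of R N) n)

variable {R}
variable {A B C N : Type} [AddCommGroup A] [Module R A] [AddCommGroup B] [Module R B]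
  [AddCommGroup C] [Module R C] [AddCommGroup N] [Module R N]

/-- short exact sequences -/
structure Ses (f : A →ₗ[R] B) (g : B →ₗ[R] C) : Prop where
  inj : Function.Injective f
  surj : Function.Surjective g
  exact : Function.Exact f g

/-- the associated short complex -/
abbrev Ses.sc {f : A →ₗ[R] B} {g : B →ₗ[R] C} (h : Ses f g) : ShortComplex (ModuleCat.{0} R) :=
  ShortComplex.mk (ModuleCat.ofHom f) (ModuleCat.ofHom g)
    (by ext x; exact h.exact.apply_apply_eq_zero x)

lemma Ses.se {f : A →ₗ[R] B} {g : B →ₗ[R] C} (h : Ses f g) : h.sc.ShortExact :=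
  ModuleCat.shortComplex_shortExact _ h.exact h.inj h.surj

lemma ev_of_zero {n : ℕ} (h : ∀ x : Abelian.Ext.{0} (ModuleCat.of R A) (ModuleCat.of R N) n, x = 0) :
    EV R n A N := ⟨fun a b => (h a).trans (h b).symm⟩

lemma EV.eq_zero {n : ℕ} (h : EV R n A N)
    (x : Abelian.Ext.{0} (ModuleCat.of R A) (ModuleCat.of R N) n) : x = 0 :=
  h.elim _ _

lemma Ses.ev_third {f : A →ₗ[R] B} {g : B →ₗ[R] C} (h : Ses f g) {n : ℕ}
    (hA : EV R n A N) (hB : EV R (n+1) B N) : EV R (n+1) C N := by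
  refine ev_of_zero fun x => ?_
  obtain ⟨y, rfl⟩ := Abelian.Ext.contravariant_sequence_exact₃ h.se _ x (hB.eq_zero _) (add_comm 1 n)
  rw [hA.eq_zero y, Abelian.Ext.comp_zero]

lemma Ses.ev_first {f : A →ₗ[R] B} {g : B →ₗ[R] C} (h : Ses f g) {n : ℕ}
    (hB : EV R n B N) (hC : EV R (n+1) C N) : EV R n A N := by
  refine ev_of_zero fun x => ?_
  obtain ⟨y, rfl⟩ := Abelian.Ext.contravariant_sequence_exact₁ h.se _ x (add_comm 1 n) (hC.eq_zero _)
  rw [hB.eq_zero y, Abelian.Ext.comp_zero]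

lemma Ses.ev_co_first {f : A →ₗ[R] B} {g : B →ₗ[R] C} (h : Ses f g) {n : ℕ}
    (hC : EV R n N C) (hB : EV R (n+1) N B) : EV R (n+1) N A := by
  refine ev_of_zero fun x => ?_
  obtain ⟨y, rfl⟩ := Abelian.Ext.covariant_sequence_exact₁ _ h.se x (hB.eq_zero _) rfl
  rw [hC.eq_zero y, Abelian.Ext.zero_comp]

lemma Ses.ev_co_third {f : A →ₗ[R] B} {g : B →ₗ[R] C} (h : Ses f g) {n : ℕ}
    (hB : EV R n N B) (hA : EV R (n+1) N A) : EV R n N C := by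
  refine ev_of_zero fun x => ?_
  obtain ⟨y, rfl⟩ := Abelian.Ext.covariant_sequence_exact₃ _ h.se x rfl (hA.eq_zero _)
  rw [hB.eq_zero y, Abelian.Ext.zero_comp]

lemma Ses.ev_one_of_extend {f : A →ₗ[R] B} {g : B →ₗ[R] C} (h : Ses f g)
    (hB : EV R 1 B N) (H : ∀ φ : A →ₗ[R] N, ∃ ψ : B →ₗ[R] N, ψ ∘ₗ f = φ) : EV R 1 C N := by
  refine ev_of_zero fun x => ?_
  obtain ⟨y, rfl⟩ := Abelian.Ext.contravariant_sequence_exact₃ h.se _ x (hB.eq_zero _) (add_comm 1 0)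
  obtain ⟨φ, rfl⟩ := Abelian.Ext.addEquiv₀.symm.surjective y
  obtain ⟨ψ, hψ⟩ := H φ.hom
  have : φ = h.sc.f ≫ ModuleCat.ofHom ψ := by
    ext x; exact (LinearMap.congr_fun hψ x).symm
  rw [this]
  simp only [Abelian.Ext.addEquiv₀_symm_apply]
  rw [← Abelian.Ext.mk₀_comp_mk₀, ← Abelian.Ext.comp_assoc _ _ _ (add_zero 1) (add_zero 0) (by simp),
    h.se.extClass_comp, Abelian.Ext.zero_comp]

lemma Ses.extend {f : A →ₗ[R] B} {g : B →ₗ[R] C} (h : Ses f g)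
    (hC : EV R 1 C N) (φ : A →ₗ[R] N) : ∃ ψ : B →ₗ[R] N, ψ ∘ₗ f = φ := by
  obtain ⟨y, hy⟩ := Abelian.Ext.contravariant_sequence_exact₁ h.se _
    (Abelian.Ext.mk₀ (ModuleCat.ofHom φ)) (add_comm 1 0) (hC.eq_zero _)
  obtain ⟨ψ, rfl⟩ := Abelian.Ext.addEquiv₀.symm.surjective y
  refine ⟨ψ.hom, ?_⟩
  simp only [Abelian.Ext.addEquiv₀_symm_apply] at hy
  rw [Abelian.Ext.mk₀_comp_mk₀] at hy
  have := Abelian.Ext.addEquiv₀.symm.injective hy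
  ext x
  exact congrArg (fun t => t.hom x) this

lemma Ses.ev_one_of_lift {f : A →ₗ[R] B} {g : B →ₗ[R] C} (h : Ses f g)
    (hB : EV R 1 N B) (H : ∀ φ : N →ₗ[R] C, ∃ ψ : N →ₗ[R] B, g ∘ₗ ψ = φ) : EV R 1 N A := by
  refine ev_of_zero fun x => ?_
  obtain ⟨y, rfl⟩ := Abelian.Ext.covariant_sequence_exact₁ _ h.se x (hB.eq_zero _) (zero_add 1)
  obtain ⟨φ, rfl⟩ := Abelian.Ext.addEquiv₀.symm.surjective y
  obtain ⟨ψ, hψ⟩ := H φ.hom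
  have : φ = ModuleCat.ofHom ψ ≫ h.sc.g := by
    ext x; exact (LinearMap.congr_fun hψ x).symm
  rw [this]
  simp only [Abelian.Ext.addEquiv₀_symm_apply]
  rw [← Abelian.Ext.mk₀_comp_mk₀, Abelian.Ext.comp_assoc _ _ _ (add_zero 0) (zero_add 1) (by simp),
    h.se.comp_extClass, Abelian.Ext.comp_zero]

lemma Ses.lift {f : A →ₗ[R] B} {g : B →ₗ[R] C} (h : Ses f g)
    (hA : EV R 1 N A) (φ : N →ₗ[R] C) : ∃ ψ : N →ₗ[R] B, g ∘ₗ ψ = φ := by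
  obtain ⟨y, hy⟩ := Abelian.Ext.covariant_sequence_exact₃ _ h.se
    (Abelian.Ext.mk₀ (ModuleCat.ofHom φ)) (zero_add 1) (hA.eq_zero _)
  obtain ⟨ψ, rfl⟩ := Abelian.Ext.addEquiv₀.symm.surjective y
  refine ⟨ψ.hom, ?_⟩
  simp only [Abelian.Ext.addEquiv₀_symm_apply] at hy
  rw [Abelian.Ext.mk₀_comp_mk₀] at hy
  have := Abelian.Ext.addEquiv₀.symm.injective hy
  ext x
  exact congrArg (fun t => t.hom x) this

lemma ev_proj (hA : Module.Projective R A) (n : ℕ) : EV R (n+1) A N := by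
  have := (IsProjective.iff_projective (R := R) A).1 hA
  exact ev_of_zero fun x => Abelian.Ext.eq_zero_of_projective x

lemma ev_inj (hN : Module.Injective R N) (n : ℕ) : EV R (n+1) A N := by
  have := (Module.injective_iff_injective_object R N).1 hN
  exact ev_of_zero fun x => Abelian.Ext.eq_zero_of_injective x

lemma ses_ker {g : B →ₗ[R] C} (hg : Function.Surjective g) : Ses (LinearMap.ker g).subtype g :=
  ⟨Subtype.val_injective, hg, LinearMap.exact_subtype_ker_map g⟩

lemma ses_quot {f : A →ₗ[R] B} (hf : Function.Injective f) : Ses f (LinearMap.range f).mkQ :=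
  ⟨hf, Submodule.mkQ_surjective _, LinearMap.exact_map_mkQ_range f⟩

lemma Ses.dual {f : A →ₗ[R] B} {g : B →ₗ[R] C} (h : Ses f g) :
    Ses (CharacterModule.dual g) (CharacterModule.dual f) := by
  refine ⟨CharacterModule.dual_injective_of_surjective _ h.surj,
    CharacterModule.dual_surjective_of_injective _ h.inj, ?_⟩
  intro c
  constructor
  · intro hc
    have hk : (LinearMap.ker g).toAddSubgroup ≤ AddMonoidHom.ker c := by
      intro x hx
      obtain ⟨a, rfl⟩ := (h.exact x).1 hx
      exact DFunLike.congr_fun hc a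
    let d : CharacterModule (B ⧸ LinearMap.ker g) := QuotientAddGroup.lift _ c hk
    refine ⟨CharacterModule.dual (LinearMap.quotKerEquivOfSurjective g h.surj).symm.toLinearMap d, ?_⟩
    ext x
    simp only [CharacterModule.dual_apply]
    change d ((LinearMap.quotKerEquivOfSurjective g h.surj).symm (g x)) = c x
    have : (LinearMap.quotKerEquivOfSurjective g h.surj).symm (g x) = Submodule.Quotient.mk x := by
      rw [LinearEquiv.symm_apply_eq]; rfl
    rw [this]; rfl
  · rintro ⟨d, rfl⟩
    ext x
    change d (g (f x)) = 0
    rw [h.exact.apply_apply_eq_zero, map_zero]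

lemma flat_iff_dual_inj : Module.Flat R A ↔ Module.Injective R (CharacterModule A) :=
  Module.Flat.iff_characterModule_injective

/-- Every module has a free cover. -/
lemma exists_cover (M : Type) [AddCommGroup M] [Module R M] :
    ∃ (P K : ModuleCat.{0} R) (f : K →ₗ[R] P) (g : P →ₗ[R] M), Module.Projective R P ∧ Ses f g :=
  ⟨ModuleCat.of R (M →₀ R), ModuleCat.of R (LinearMap.ker (Finsupp.linearCombination R (id : M → M))),
    _, Finsupp.linearCombination R (id : M → M), inferInstanceAs (Module.Projective R (M →₀ R)),
    ses_ker (fun m => ⟨Finsupp.single m 1, by simp⟩)⟩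

/-- Every module embeds in an injective. -/
lemma exists_emb (M : Type) [AddCommGroup M] [Module R M] :
    ∃ (I K : ModuleCat.{0} R) (f : M →ₗ[R] I) (g : I →ₗ[R] K), Module.Injective R I ∧ Ses f g := by
  let f : ModuleCat.of R M ⟶ _ := Injective.ι (ModuleCat.of R M)
  refine ⟨Injective.under (ModuleCat.of R M), ModuleCat.of R (_ ⧸ LinearMap.range f.hom), f.hom, _,
    ?_, ses_quot ?_⟩
  · exact (Module.injective_iff_injective_object R _).2 (inferInstanceAs (Injective (Injective.under (ModuleCat.of R M))))
  · exact (ModuleCat.mono_iff_injective f).1 inferInstance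

end extbasics
end GW

namespace GW

section duality
open TensorProduct

variable {R : Type} [CommRing R]

lemma fin_repr {I : Type} [AddCommGroup I] [Module R I] {b : ℕ}
    (Ψ : ((Fin b → R) →ₗ[R] R) →ₗ[R] I) :
    ∃ s : (Fin b → R) ⊗[R] I, ∀ u, TensorProduct.lid R I (u.rTensor I s) = Ψ u := by
  classical
  refine ⟨∑ i, (Pi.single i 1) ⊗ₜ Ψ (LinearMap.proj i), fun u => ?_⟩
  have hu : u = ∑ i, u (Pi.single i 1) • (LinearMap.proj i : (Fin b → R) →ₗ[R] R) := by
    apply LinearMap.pi_ext'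
    intro i
    ext
    simp [Pi.single_apply]
  conv_rhs => rw [hu]
  simp [map_sum]

lemma fin_sep {I : Type} [AddCommGroup I] [Module R I] {b : ℕ} (y : (Fin b → R) ⊗[R] I)
    (h : ∀ u : (Fin b → R) →ₗ[R] R, TensorProduct.lid R I (u.rTensor I y) = 0) : y = 0 := by
  classical
  have hid : (LinearMap.id : (Fin b → R) →ₗ[R] (Fin b → R)) =
      ∑ i, (LinearMap.single R (fun _ => R) i) ∘ₗ (LinearMap.proj i) := by
    apply LinearMap.pi_ext'
    intro i
    ext j
    simp [Pi.single_apply]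
  have h1 : (LinearMap.rTensorHom I LinearMap.id) y = y := by simp
  rw [← h1, hid, map_sum, LinearMap.sum_apply]
  refine Finset.sum_eq_zero fun i _ => ?_
  have := h (LinearMap.proj i)
  rw [LinearEquiv.map_eq_zero_iff] at this
  simp [LinearMap.rTensor_comp, this]

/-- evaluation of tensors on functionals -/
def theta {G I : Type} [AddCommGroup G] [Module R G] [AddCommGroup I] [Module R I]
    (s : G ⊗[R] I) : (G →ₗ[R] R) →ₗ[R] I :=
  (TensorProduct.lid R I).toLinearMap ∘ₗ (LinearMap.rTensorHom (R := R) I).flip s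

lemma theta_apply {G I : Type} [AddCommGroup G] [Module R G] [AddCommGroup I] [Module R I]
    (s : G ⊗[R] I) (u : G →ₗ[R] R) : theta s u = TensorProduct.lid R I (u.rTensor I s) := rfl

lemma theta_rTensor {G H I : Type} [AddCommGroup G] [Module R G] [AddCommGroup H] [Module R H]
    [AddCommGroup I] [Module R I] (f : G →ₗ[R] H)
    (s : G ⊗[R] I) (u : H →ₗ[R] R) : theta (f.rTensor I s) u = theta s (u ∘ₗ f) := by
  simp [theta_apply, LinearMap.rTensor_comp]

lemma dual_ext_of_tensor {L : Type} [AddCommGroup L] [Module R L] [Module.Finite R L] {k : ℕ}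
    (f : L →ₗ[R] (Fin k → R))
    (H : ∀ (I : ModuleCat.{0} R), Module.Injective R I → Function.Injective (f.rTensor I))
    (φ : L →ₗ[R] R) : ∃ ψ : (Fin k → R) →ₗ[R] R, ψ ∘ₗ f = φ := by
  suffices hs : Function.Surjective (f.lcomp R R) from hs φ
  apply CharacterModule.surjective_of_dual_injective
  rw [injective_iff_map_eq_zero]
  intro c hc
  obtain ⟨m, p, hp⟩ := Module.Finite.exists_fin' R L
  have hI : Module.Injective R (CharacterModule R) := flat_iff_dual_inj.1 inferInstance
  let φc : (L →ₗ[R] R) →ₗ[R] CharacterModule R :=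
    CharacterModule.homEquiv.symm (CharacterModule.dual (TensorProduct.rid R (L →ₗ[R] R)).toLinearMap c)
  have hφc : ∀ h r, φc h r = c (r • h) := by
    intro h r
    change c ((TensorProduct.rid R _) (h ⊗ₜ r)) = _
    rw [TensorProduct.rid_tmul]
  have hpd : Function.Injective (p.lcomp R R) := by
    intro a b hab
    exact LinearMap.cancel_right hp |>.1 hab
  obtain ⟨Φ, hΦ⟩ := hI.out (p.lcomp R R) hpd φc
  obtain ⟨s, hs⟩ := fin_repr Φ
  have key : ∀ h, theta (p.rTensor (CharacterModule R) s) h = φc h := by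
    intro h
    rw [theta_rTensor, theta_apply, hs, ← hΦ]; rfl
  have h0 : f.rTensor (CharacterModule R) (p.rTensor (CharacterModule R) s) = 0 := by
    apply fin_sep
    intro u
    rw [← theta_apply, theta_rTensor, key]
    ext r
    rw [hφc]
    have := DFunLike.congr_fun hc (r • u)
    exact this
  have ht := (injective_iff_map_eq_zero _).1 (H (ModuleCat.of R (CharacterModule R)) hI) _ h0
  ext h
  have := key h
  rw [ht] at this
  have h2 := DFunLike.congr_fun this 1
  rw [hφc, one_smul] at h2
  rw [← h2]
  simp only [theta_apply, map_zero]
  rfl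

lemma tensor_of_dual_ext {L F : Type} [AddCommGroup L] [Module R L] [Module.FinitePresentation R L]
    [AddCommGroup F] [Module R F]
    (f : L →ₗ[R] F) (H : ∀ φ : L →ₗ[R] R, ∃ ψ : F →ₗ[R] R, ψ ∘ₗ f = φ)
    (I : Type) [AddCommGroup I] [Module R I] (hI : Module.Injective R I) :
    Function.Injective (f.rTensor I) := by
  rw [injective_iff_map_eq_zero]
  intro t ht
  obtain ⟨a, b, p, q, hp, hqp⟩ := Module.FinitePresentation.exists_fin' R L
  obtain ⟨s, rfl⟩ := LinearMap.rTensor_surjective I hp t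
  have h1 : ∀ h : L →ₗ[R] R, theta s (h ∘ₗ p) = 0 := by
    intro h
    obtain ⟨ψ, rfl⟩ := H h
    rw [← theta_rTensor, ← theta_rTensor, ht]
    simp [theta_apply]
  have hker : LinearMap.ker (q.lcomp R R) ≤ LinearMap.ker (theta s) := by
    intro u hu
    have hu' : u ∘ₗ q = 0 := hu
    have : ∃ h : L →ₗ[R] R, h ∘ₗ p = u := by
      have hk : LinearMap.ker p ≤ LinearMap.ker u := by
        intro x hx
        obtain ⟨y, rfl⟩ := (hqp x).1 hx
        exact LinearMap.congr_fun hu' y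
      refine ⟨(LinearMap.ker p).liftQ u hk ∘ₗ
        (LinearMap.quotKerEquivOfSurjective p hp).symm.toLinearMap, ?_⟩
      ext x
      have : (LinearMap.quotKerEquivOfSurjective p hp).symm (p (Pi.single x 1)) =
          Submodule.Quotient.mk (Pi.single x 1) := by
        rw [LinearEquiv.symm_apply_eq]; rfl
      simp [this]
    obtain ⟨h, rfl⟩ := this
    exact h1 h
  obtain ⟨Ψ, hΨ⟩ := hI.out ((LinearMap.ker (q.lcomp R R)).liftQ (q.lcomp R R) le_rfl)
    (by rw [← LinearMap.ker_eq_bot]; exact Submodule.ker_liftQ_eq_bot _ _ _ le_rfl)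
    ((LinearMap.ker (q.lcomp R R)).liftQ (theta s) hker)
  have hΨ' : ∀ u, Ψ (u ∘ₗ q) = theta s u := fun u => hΨ (Submodule.Quotient.mk u)
  obtain ⟨s1, hs1⟩ := fin_repr Ψ
  have : q.rTensor I s1 = s := by
    rw [← sub_eq_zero]
    apply fin_sep
    intro u
    rw [map_sub, map_sub, ← theta_apply, ← theta_apply, theta_rTensor, theta_apply, hs1, hΨ', sub_self]
  rw [← this, ← LinearMap.rTensor_comp_apply, hqp.linearMap_comp_eq_zero]
  simp

lemma tensor_inj_iff {A B : Type} [AddCommGroup A] [Module R A] [AddCommGroup B] [Module R B]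
    (f : A →ₗ[R] B) (X : Type) [AddCommGroup X] [Module R X] :
    Function.Injective (f.rTensor X) ↔
      ∀ φ : A →ₗ[R] CharacterModule X, ∃ ψ : B →ₗ[R] CharacterModule X, ψ ∘ₗ f = φ :=
  rTensor_injective_iff_lcomp_surjective

lemma ev_flat_char (n : ℕ) : ∀ {A X : Type} [AddCommGroup A] [Module R A] [AddCommGroup X]
    [Module R X], Module.Flat R A → EV R (n+1) A (CharacterModule X) := by
  induction n with
  | zero =>
    intro A X _ _ _ _ hA
    obtain ⟨P, K, f, g, hP, h⟩ := exists_cover (R := R) X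
    have hPi : Module.Injective R (CharacterModule P) := flat_iff_dual_inj.1 inferInstance
    refine h.dual.ev_one_of_lift (ev_inj hPi 0) fun φ => ?_
    have hi : Function.Injective (f.lTensor A) := Module.Flat.lTensor_preserves_injective_linearMap f h.inj
    obtain ⟨c, hc⟩ := CharacterModule.dual_surjective_of_injective _ hi (CharacterModule.homEquiv φ)
    refine ⟨CharacterModule.homEquiv.symm c, ?_⟩
    ext a k
    have := DFunLike.congr_fun hc (a ⊗ₜ k)
    exact this
  | succ n ih =>
    intro A X _ _ _ _ hA
    obtain ⟨P, K, f, g, hP, h⟩ := exists_cover (R := R) X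
    have hPi : Module.Injective R (CharacterModule P) := flat_iff_dual_inj.1 inferInstance
    exact h.dual.ev_co_first (ih hA) (ev_inj hPi _)

lemma flat_of_ev_fp {X : Type} [AddCommGroup X] [Module R X]
    (H : ∀ M : ModuleCat.{0} R, Module.FinitePresentation R M → EV R 1 M (CharacterModule X)) :
    Module.Flat R X := by
  rw [Module.Flat.iff_rTensor_injective]
  intro J hJ
  rw [tensor_inj_iff]
  have hs : Ses J.subtype (J.mkQ) :=
    ⟨Subtype.val_injective, J.mkQ_surjective, LinearMap.exact_subtype_mkQ J⟩
  refine hs.extend (H (ModuleCat.of R (R ⧸ J)) ?_)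
  exact Module.finitePresentation_of_surjective J.mkQ J.mkQ_surjective (by rw [Submodule.ker_mkQ]; exact hJ)

lemma ev_all_of_fp (n : ℕ) : ∀ {X : Type} [AddCommGroup X] [Module R X],
    (∀ M : ModuleCat.{0} R, Module.FinitePresentation R M → EV R (n+1) M (CharacterModule X)) →
    ∀ M : ModuleCat.{0} R, EV R (n+1) M (CharacterModule X) := by
  induction n with
  | zero =>
    intro X _ _ H M
    have := flat_of_ev_fp H
    exact ev_inj (flat_iff_dual_inj.1 this) 0
  | succ n ih =>
    intro X _ _ H M
    obtain ⟨P, K, f, g, hP, h⟩ := exists_cover (R := R) X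
    have hPi : Module.Injective R (CharacterModule P) := flat_iff_dual_inj.1 inferInstance
    refine h.dual.ev_co_first (ih (X := K) (fun N hN => ?_) M) (ev_inj hPi _)
    exact h.dual.ev_co_third (ev_inj hPi _) (H N hN)

end duality
end GW

namespace GW

section coherent

variable {R : Type} [CommRing R]

lemma fp_sub (hR : IsCoherentRing R) : ∀ (n : ℕ) (N : Submodule R (Fin n → R)), N.FG →
    Module.FinitePresentation R N := by
  intro n
  induction n with
  | zero =>
    intro N hN
    have : Module.Finite R N := .of_fg hN
    exact Module.finitePresentation_of_projective R N
  | succ n ih =>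
    intro N hN
    have : Module.Finite R N := .of_fg hN
    let l : N →ₗ[R] R := LinearMap.proj 0 ∘ₗ N.subtype
    have hJ : Module.FinitePresentation R (LinearMap.range l) :=
      hR (LinearMap.range l) (Submodule.FG.of_finite)
    have hk : (LinearMap.ker l.rangeRestrict).FG :=
      Module.FinitePresentation.fg_ker l.rangeRestrict l.surjective_rangeRestrict
    have : Module.Finite R (LinearMap.ker l.rangeRestrict) := .of_fg hk
    let κ : LinearMap.ker l.rangeRestrict →ₗ[R] (Fin n → R) :=
      (LinearMap.funLeft R R Fin.succ) ∘ₗ N.subtype ∘ₗ (LinearMap.ker l.rangeRestrict).subtype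
    have hκ : Function.Injective κ := by
      rw [injective_iff_map_eq_zero]
      rintro ⟨x, hx⟩ h
      have h0 : (x : Fin (n+1) → R) 0 = 0 := congrArg Subtype.val hx
      ext i
      refine Fin.cases ?_ (fun j => ?_) i
      · exact h0
      · exact congrFun h j
    have := ih (LinearMap.range κ) (Submodule.FG.of_finite)
    have : Module.FinitePresentation R (LinearMap.ker l.rangeRestrict) :=
      Module.FinitePresentation.of_equiv (R := R) (M := LinearMap.range κ)
        (N := LinearMap.ker l.rangeRestrict) (LinearEquiv.ofInjective κ hκ).symm
    exact Module.finitePresentation_of_ker l.rangeRestrict l.surjective_rangeRestrict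

lemma cover_fp (hR : IsCoherentRing R) (M : Type) [AddCommGroup M] [Module R M]
    (hM : Module.FinitePresentation R M) :
    ∃ (k : ℕ) (L : ModuleCat.{0} R) (f : L →ₗ[R] (Fin k → R)) (g : (Fin k → R) →ₗ[R] M),
      Module.FinitePresentation R L ∧ Ses f g := by
  obtain ⟨k, g, hg⟩ := Module.Finite.exists_fin' R M
  exact ⟨k, ModuleCat.of R (LinearMap.ker g), _, g,
    fp_sub hR k _ (Module.FinitePresentation.fg_ker g hg), ses_ker hg⟩

lemma ev_fp_iff (hR : IsCoherentRing R) (n : ℕ) : ∀ (M : ModuleCat.{0} R),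
    Module.FinitePresentation R M → (EV R (n+1) M R ↔
      ∀ I : ModuleCat.{0} R, Module.Injective R I → EV R (n+1) M (CharacterModule I)) := by
  induction n with
  | zero =>
    intro M hM
    obtain ⟨k, L, f, g, hL, h⟩ := cover_fp hR M hM
    constructor
    · intro H I hI
      refine h.ev_one_of_extend (ev_proj inferInstance 0) ?_
      rw [← tensor_inj_iff]
      exact tensor_of_dual_ext f (h.extend H) I hI
    · intro H
      refine h.ev_one_of_extend (ev_proj inferInstance 0) ?_
      refine dual_ext_of_tensor f fun I hI => ?_
      rw [tensor_inj_iff]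
      exact h.extend (H I hI)
  | succ n ih =>
    intro M hM
    obtain ⟨k, L, f, g, hL, h⟩ := cover_fp hR M hM
    have key : ∀ (X : Type) [AddCommGroup X] [Module R X], EV R (n+1+1) M X ↔ EV R (n+1) L X :=
      fun X _ _ => ⟨fun H => h.ev_first (ev_proj inferInstance _) H,
        fun H => h.ev_third H (ev_proj inferInstance _)⟩
    rw [key, ih L hL]
    exact forall₂_congr fun I _ => (key _).symm

lemma ev_mono (hR : IsCoherentRing R) {X : Type} [AddCommGroup X] [Module R X] {n m : ℕ}
    (hnm : n ≤ m)
    (H : ∀ M : ModuleCat.{0} R, Module.FinitePresentation R M → EV R (n+1) M X) :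
    ∀ M : ModuleCat.{0} R, Module.FinitePresentation R M → EV R (m+1) M X := by
  induction hnm with
  | refl => exact H
  | step _ ih =>
    intro M hM
    obtain ⟨k, L, f, g, hL, h⟩ := cover_fp hR M hM
    exact h.ev_third (ih L hL) (ev_proj inferInstance _)

end coherent

section splice

lemma int_chain {α : Type*} (r : α → α → Prop) (h1 : ∀ a, ∃ b, r a b) (h2 : ∀ a, ∃ b, r b a)
    (x : α) : ∃ Z : ℤ → α, Z 0 = x ∧ ∀ i, r (Z i) (Z (i + 1)) := by
  choose s hs using h1
  choose p hp using h2
  let Z : ℤ → α := fun i => match i with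
    | Int.ofNat n => s^[n] x
    | Int.negSucc n => p^[n+1] x
  refine ⟨Z, rfl, fun i => ?_⟩
  match i with
  | Int.ofNat n =>
    change r (s^[n] x) (s^[n+1] x)
    rw [Function.iterate_succ_apply']
    exact hs _
  | Int.negSucc 0 =>
    exact hp x
  | Int.negSucc (n+1) =>
    change r (p^[n+1+1] x) (p^[n+1] x)
    rw [Function.iterate_succ_apply' p (n+1)]
    exact hp _

variable {R : Type} [CommRing R]

lemma splice (C PF : ModuleCat.{0} R → Prop)
    (hl : ∀ K, C K → ∃ (L F : ModuleCat.{0} R) (f : L →ₗ[R] F) (g : F →ₗ[R] K), C L ∧ PF F ∧ Ses f g)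
    (hr : ∀ K, C K → ∃ (L F : ModuleCat.{0} R) (f : K →ₗ[R] F) (g : F →ₗ[R] L), C L ∧ PF F ∧ Ses f g)
    (M : ModuleCat.{0} R) (hM : C M) :
    ∃ (Z P : ℤ → ModuleCat.{0} R) (f : ∀ i, Z i →ₗ[R] P i) (g : ∀ i, P i →ₗ[R] Z (i+1)),
      (∀ i, C (Z i)) ∧ (∀ i, PF (P i)) ∧ (∀ i, Ses (f i) (g i)) ∧ Z 0 = M := by
  let r : {K // C K} → {K // C K} → Prop := fun A B =>
    ∃ (F : ModuleCat.{0} R) (f : A.1 →ₗ[R] F) (g : F →ₗ[R] B.1), PF F ∧ Ses f g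
  obtain ⟨Z, h0, hZ⟩ := int_chain r
    (fun A => by
      obtain ⟨L, F, f, g, h1, h2, h3⟩ := hr A.1 A.2
      exact ⟨⟨L, h1⟩, F, f, g, h2, h3⟩)
    (fun A => by
      obtain ⟨L, F, f, g, h1, h2, h3⟩ := hl A.1 A.2
      exact ⟨⟨L, h1⟩, F, f, g, h2, h3⟩) ⟨M, hM⟩
  choose P f g hP hs using hZ
  exact ⟨fun i => (Z i).1, P, f, g, fun i => (Z i).2, hP, hs, congrArg Subtype.val h0⟩

lemma exact_splice {A B C D E : Type} [AddCommGroup A] [Module R A] [AddCommGroup B] [Module R B]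
    [AddCommGroup C] [Module R C] [AddCommGroup D] [Module R D] [AddCommGroup E] [Module R E]
    {g0 : A →ₗ[R] B} {f1 : B →ₗ[R] C} {g1 : C →ₗ[R] D} {f2 : D →ₗ[R] E}
    (h0 : Function.Surjective g0) (h1 : Function.Exact f1 g1) (h2 : Function.Injective f2) :
    Function.Exact (f1 ∘ₗ g0) (f2 ∘ₗ g1) := by
  intro y
  rw [LinearMap.comp_apply, map_eq_zero_iff f2 h2, h1 y]
  constructor
  · rintro ⟨b, rfl⟩
    obtain ⟨a, rfl⟩ := h0 b
    exact ⟨a, rfl⟩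
  · rintro ⟨a, rfl⟩
    exact ⟨g0 a, rfl⟩

lemma ker_equiv {A B C D : Type} [AddCommGroup A] [Module R A] [AddCommGroup B] [Module R B]
    [AddCommGroup C] [Module R C] [AddCommGroup D] [Module R D]
    {f : A →ₗ[R] B} {g : B →ₗ[R] C} {f2 : C →ₗ[R] D} (h : Ses f g) (h2 : Function.Injective f2) :
    Nonempty (A ≃ₗ[R] LinearMap.ker (f2 ∘ₗ g)) := by
  have : LinearMap.range f = LinearMap.ker (f2 ∘ₗ g) := by
    rw [LinearMap.ker_comp_of_ker_eq_bot _ (LinearMap.ker_eq_bot.2 h2), h.exact.linearMap_ker_eq]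
  exact ⟨(LinearEquiv.ofInjective f h.inj).trans (LinearEquiv.ofEq _ _ this)⟩

lemma Ses.factor {A B C N : Type} [AddCommGroup A] [Module R A] [AddCommGroup B] [Module R B]
    [AddCommGroup C] [Module R C] [AddCommGroup N] [Module R N]
    {f : A →ₗ[R] B} {g : B →ₗ[R] C} (h : Ses f g) (u : B →ₗ[R] N) (hu : u ∘ₗ f = 0) :
    ∃ v : C →ₗ[R] N, v ∘ₗ g = u := by
  have hk : LinearMap.ker g ≤ LinearMap.ker u := by
    intro x hx
    obtain ⟨y, rfl⟩ := (h.exact x).1 hx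
    exact LinearMap.congr_fun hu y
  refine ⟨(LinearMap.ker g).liftQ u hk ∘ₗ
    (LinearMap.quotKerEquivOfSurjective g h.surj).symm.toLinearMap, ?_⟩
  ext x
  have : (LinearMap.quotKerEquivOfSurjective g h.surj).symm (g x) = Submodule.Quotient.mk x := by
    rw [LinearEquiv.symm_apply_eq]; rfl
  simp [this]

lemma isGFlat_of_class (C : ModuleCat.{0} R → Prop)
    (hl : ∀ K, C K → ∃ (L F : ModuleCat.{0} R) (f : L →ₗ[R] F) (g : F →ₗ[R] K),
      C L ∧ Module.Flat R F ∧ Ses f g)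
    (hr : ∀ K, C K → ∃ (L F : ModuleCat.{0} R) (f : K →ₗ[R] F) (g : F →ₗ[R] L),
      C L ∧ Module.Flat R F ∧ Ses f g)
    (hC : ∀ K, C K → ∀ I : ModuleCat.{0} R, Module.Injective R I → EV R 1 K (CharacterModule I))
    (M : ModuleCat.{0} R) (hM : C M) : IsGFlat R M := by
  obtain ⟨Z, P, f, g, hZ, hP, hs, rfl⟩ := splice C (fun F => Module.Flat R F) hl hr M hM
  refine ⟨P, fun i => f (i+1) ∘ₗ g i, hP, fun i => exact_splice (hs i).surj (hs _).exact (hs _).inj,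
    fun I hI i => ?_, ker_equiv (hs 0) (hs _).inj⟩
  have hinj : ∀ i, Function.Injective ((f i).lTensor I) := by
    intro i
    rw [LinearMap.lTensor_inj_iff_rTensor_inj, tensor_inj_iff]
    exact (hs i).extend (hC _ (hZ _) I hI)
  rw [LinearMap.lTensor_comp, LinearMap.lTensor_comp]
  exact exact_splice (LinearMap.lTensor_surjective _ (hs i).surj)
    (lTensor_exact _ (hs _).exact (hs _).surj) (hinj _)

lemma isGProj_of_class (C : ModuleCat.{0} R → Prop)
    (hl : ∀ K, C K → ∃ (L F : ModuleCat.{0} R) (f : L →ₗ[R] F) (g : F →ₗ[R] K),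
      C L ∧ Module.Projective R F ∧ Ses f g)
    (hr : ∀ K, C K → ∃ (L F : ModuleCat.{0} R) (f : K →ₗ[R] F) (g : F →ₗ[R] L),
      C L ∧ Module.Projective R F ∧ Ses f g)
    (hC : ∀ K, C K → ∀ Q : ModuleCat.{0} R, Module.Projective R Q → EV R 1 K Q)
    (M : ModuleCat.{0} R) (hM : C M) : IsGProj R M := by
  obtain ⟨Z, P, f, g, hZ, hP, hs, rfl⟩ := splice C (fun F => Module.Projective R F) hl hr M hM
  refine ⟨P, fun i => f (i+1) ∘ₗ g i, hP, fun i => exact_splice (hs i).surj (hs _).exact (hs _).inj,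
    fun Q hQ i => ?_, ker_equiv (hs 0) (hs _).inj⟩
  intro u
  constructor
  · intro hu
    have hu' : u ∘ₗ f (i+1) = 0 := by
      rw [← LinearMap.cancel_right (hs i).surj]
      exact hu
    obtain ⟨v, rfl⟩ := (hs (i+1)).factor u hu'
    obtain ⟨w, hw⟩ := (hs (i+1+1)).extend (hC _ (hZ _) Q hQ) v
    exact ⟨w, by rw [← hw]; rfl⟩
  · rintro ⟨w, rfl⟩
    ext x
    have := (hs (i+1)).exact.apply_apply_eq_zero (g i x)
    simp [this]

/-- syzygies in complexes which stay exact under `Hom(-, X)`. -/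
lemma ev_ker {X : Type} [AddCommGroup X] [Module R X]
    (P : ℤ → ModuleCat.{0} R) (d : ∀ i, P i →ₗ[R] P (i + 1))
    (hP : ∀ i n, EV R (n+1) (P i) X)
    (hd : ∀ i, Function.Exact (d i) (d (i + 1)))
    (hX : ∀ i (u : P (i+1) →ₗ[R] X), u ∘ₗ d i = 0 → ∃ v : P (i+1+1) →ₗ[R] X, v ∘ₗ d (i+1) = u)
    (n : ℕ) : ∀ k, EV R (n+1) (LinearMap.ker (d k)) X := by
  have hses : ∀ i, ∃ g : P i →ₗ[R] LinearMap.ker (d (i+1)),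
      Ses (LinearMap.ker (d i)).subtype g ∧ ∀ x, (g x : P (i+1)) = d i x := by
    intro i
    refine ⟨(d i).codRestrict _ (fun x => LinearMap.mem_ker.2 ((hd i).apply_apply_eq_zero x)), ⟨Subtype.val_injective, ?_, ?_⟩,
      fun x => rfl⟩
    · rintro ⟨y, hy⟩
      obtain ⟨x, rfl⟩ := (hd i y).1 hy
      exact ⟨x, rfl⟩
    · intro x
      constructor
      · intro hx
        exact ⟨⟨x, LinearMap.mem_ker.2 (congrArg Subtype.val hx)⟩, rfl⟩
      · rintro ⟨⟨y, hy⟩, rfl⟩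
        exact Subtype.ext hy
  induction n with
  | zero =>
    suffices H : ∀ i k, i + 1 + 1 + 1 = k → EV R 1 (LinearMap.ker (d k)) X from
      fun k => H (k-3) k (by ring)
    rintro i k rfl
    obtain ⟨g, hg, hg'⟩ := hses (i+1+1)
    obtain ⟨g1, hg1, hg1'⟩ := hses (i+1)
    refine hg.ev_one_of_extend (hP _ _) fun φ => ?_
    obtain ⟨v, hv⟩ := hX i (φ ∘ₗ g1) (by
      ext x
      have : g1 (d i x) = 0 := by
        ext; rw [hg1']; exact (hd i).apply_apply_eq_zero x
      simp [this])
    refine ⟨v, ?_⟩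
    rw [← LinearMap.cancel_right hg1.surj, ← hv]
    ext x
    simp [hg1']
  | succ n ih =>
    suffices H : ∀ i k, i + 1 = k → EV R (n+1+1) (LinearMap.ker (d k)) X from
      fun k => H (k-1) k (by ring)
    rintro i k rfl
    obtain ⟨g, hg, hg'⟩ := hses i
    exact hg.ev_third (ih i) (hP _ _)

lemma ev_congr {A B X : Type} [AddCommGroup A] [Module R A] [AddCommGroup B] [Module R B]
    [AddCommGroup X] [Module R X] (e : A ≃ₗ[R] B) {n : ℕ} (h : EV R (n+1) B X) : EV R (n+1) A X := by
  have hs : Ses e.toLinearMap (0 : B →ₗ[R] PUnit.{1}) := by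
    refine ⟨e.injective, fun _ => ⟨0, rfl⟩, fun y => ⟨fun _ => e.surjective y, fun _ => rfl⟩⟩
  exact hs.ev_first h (ev_proj inferInstance _)

lemma ev_of_gproj {M : ModuleCat.{0} R} (hM : IsGProj R M) (n : ℕ) : EV R (n+1) M R := by
  obtain ⟨P, d, hP, hd, hQ, ⟨e⟩⟩ := hM
  refine ev_congr e (ev_ker P d (fun i n => ev_proj (hP i) n) hd (fun i u hu => ?_) n 0)
  exact (hQ (ModuleCat.of R R) (inferInstanceAs (Module.Projective R R)) i u).1 hu

lemma dual_exact {A B C : Type} [AddCommGroup A] [Module R A] [AddCommGroup B] [Module R B]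
    [AddCommGroup C] [Module R C] {f : A →ₗ[R] B} {g : B →ₗ[R] C} (h : Function.Exact f g)
    (c : CharacterModule B) (hc : CharacterModule.dual f c = 0) :
    ∃ e, CharacterModule.dual g e = c := by
  have hs := (ses_ker g.surjective_rangeRestrict).dual
  obtain ⟨c', hc'⟩ := (hs.exact c).1 (by
    ext ⟨x, hx⟩
    rw [LinearMap.ker_rangeRestrict] at hx
    obtain ⟨y, rfl⟩ := (h x).1 hx
    exact DFunLike.congr_fun hc y)
  obtain ⟨e, rfl⟩ := CharacterModule.dual_surjective_of_injective (LinearMap.range g).subtype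
    Subtype.val_injective c'
  exact ⟨e, hc'⟩

lemma ev_of_gflat {M : ModuleCat.{0} R} (hM : IsGFlat R M) (I : ModuleCat.{0} R)
    (hI : Module.Injective R I) (n : ℕ) : EV R (n+1) M (CharacterModule I) := by
  obtain ⟨P, d, hP, hd, hQ, ⟨e⟩⟩ := hM
  refine ev_congr e (ev_ker P d (fun i n => ev_flat_char n (hP i)) hd (fun i u hu => ?_) n 0)
  have hex := hQ I hI i
  rw [← LinearMap.rTensor_exact_iff_lTensor_exact] at hex
  obtain ⟨e, he⟩ := dual_exact hex (CharacterModule.homEquiv u) (by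
    have h2 : CharacterModule.homEquiv.symm (CharacterModule.dual ((d i).rTensor I)
      (CharacterModule.homEquiv u)) = 0 := hu
    exact CharacterModule.homEquiv.symm.injective (h2.trans (map_zero _).symm))
  refine ⟨CharacterModule.homEquiv.symm e, ?_⟩
  apply CharacterModule.homEquiv.injective
  rw [← he]
  apply CharacterModule.homEquiv.symm.injective
  rw [LinearEquiv.symm_apply_apply]
  rfl

end splice
end GW

namespace GW

section syz

variable {R : Type} [CommRing R]

/-- `K` is an `n`-th syzygy of `N`. -/
def Syz : ℕ → ModuleCat.{0} R → ModuleCat.{0} R → Prop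
  | 0, N, K => K = N
  | (n + 1), N, K => ∃ (N' P : ModuleCat.{0} R) (f : N' →ₗ[R] P) (g : P →ₗ[R] N),
      Module.Projective R P ∧ Ses f g ∧ Syz n N' K

lemma flat_of_syz (n : ℕ) : ∀ (X K : ModuleCat.{0} R),
    (∀ M : ModuleCat.{0} R, EV R (n+1) M (CharacterModule X)) → Syz n X K → Module.Flat R K := by
  induction n with
  | zero =>
    rintro X K H rfl
    exact flat_of_ev_fp fun M _ => H M
  | succ n ih =>
    rintro X K H ⟨N', P, f, g, hP, h, hK⟩
    have hPi : Module.Injective R (CharacterModule P) := flat_iff_dual_inj.1 inferInstance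
    exact ih N' K (fun M => h.dual.ev_co_third (ev_inj hPi _) (H M)) hK

lemma ev_syz {X : Type} [AddCommGroup X] [Module R X] (n : ℕ) : ∀ (N K : ModuleCat.{0} R),
    Syz n N K → EV R (n+1) N X → EV R 1 K X := by
  induction n with
  | zero =>
    rintro X K rfl H
    exact H
  | succ n ih =>
    rintro X K ⟨N', P, f, g, hP, h, hK⟩ H
    exact ih N' K hK (h.ev_first (ev_proj hP _) H)

lemma Syz.append (n : ℕ) : ∀ {N K L P : ModuleCat.{0} R} {f : L →ₗ[R] P} {g : P →ₗ[R] K},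
    Syz n N K → Module.Projective R P → Ses f g → Syz (n+1) N L := by
  induction n with
  | zero =>
    rintro N K L P f g rfl hP h
    exact ⟨L, P, f, g, hP, h, rfl⟩
  | succ n ih =>
    rintro N K L P f g ⟨N', P', f', g', hP', h', hK⟩ hP h
    exact ⟨N', P', f', g', hP', h', ih hK hP h⟩

lemma syz_zero (n : ℕ) : Syz n (ModuleCat.of R PUnit.{1}) (ModuleCat.of R PUnit.{1}) := by
  induction n with
  | zero => rfl
  | succ n ih =>
    refine ⟨ModuleCat.of R PUnit, ModuleCat.of R PUnit, 0, 0,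
      inferInstanceAs (Module.Projective R PUnit.{1}), ⟨?_, ?_, ?_⟩, ih⟩
    · exact fun _ _ _ => rfl
    · exact fun _ => ⟨0, rfl⟩
    · exact fun _ => ⟨fun _ => ⟨0, rfl⟩, fun _ => rfl⟩

lemma syz_proj (n : ℕ) (P : ModuleCat.{0} R) (hP : Module.Projective R P) :
    ∃ N : ModuleCat.{0} R, Syz n N P := by
  cases n with
  | zero => exact ⟨P, rfl⟩
  | succ n =>
    refine ⟨_, (syz_zero n).append n (L := P) (P := P) (f := LinearMap.id) (g := 0) hP ⟨?_, ?_, ?_⟩⟩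
    · exact fun _ _ h => h
    · exact fun _ => ⟨0, rfl⟩
    · exact fun x => ⟨fun _ => ⟨x, rfl⟩, fun _ => rfl⟩

lemma horseshoe (n : ℕ) : ∀ {N I N'' K : ModuleCat.{0} R} {a : N →ₗ[R] I} {b : I →ₗ[R] N''},
    Ses a b → Syz n N K → ∃ (KI K'' : ModuleCat.{0} R) (f : K →ₗ[R] KI) (g : KI →ₗ[R] K''),
      Syz n I KI ∧ Syz n N'' K'' ∧ Ses f g := by
  induction n with
  | zero =>
    rintro N I N'' K a b h rfl
    exact ⟨I, N'', a, b, rfl, rfl, h⟩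
  | succ n ih =>
    rintro N I N'' K a b h ⟨N', P, f, g, hP, hs, hK⟩
    obtain ⟨P2, _, _, g2, hP2, hs2⟩ := exists_cover (R := R) N''
    obtain ⟨s, hsl⟩ := Module.projective_lifting_property b g2 h.surj
    have hsl' : ∀ q, b (s q) = g2 q := fun q => LinearMap.congr_fun hsl q
    have hba : ∀ x, b (a x) = 0 := fun x => h.exact.apply_apply_eq_zero x
    have hgf : ∀ x, g (f x) = 0 := fun x => hs.exact.apply_apply_eq_zero x
    let π : (P × P2) →ₗ[R] I := LinearMap.coprod (a ∘ₗ g) s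
    have hπa : ∀ p q, π (p, q) = a (g p) + s q := fun p q => by simp [π]
    have hπ : Function.Surjective π := by
      intro y
      obtain ⟨q, hq⟩ := hs2.surj (b y)
      have h1 : b (y - s q) = 0 := by rw [map_sub, hsl', hq, sub_self]
      obtain ⟨x, hx⟩ := (h.exact _).1 h1
      obtain ⟨p, rfl⟩ := hs.surj x
      exact ⟨(p, q), by rw [hπa, hx, sub_add_cancel]⟩
    let u : N' →ₗ[R] LinearMap.ker π := LinearMap.codRestrict _ (LinearMap.inl R P P2 ∘ₗ f) (fun x => by
      rw [LinearMap.mem_ker]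
      change π (f x, 0) = 0
      rw [hπa, hgf, map_zero, map_zero, add_zero])
    let v : LinearMap.ker π →ₗ[R] LinearMap.ker g2 :=
      LinearMap.codRestrict _ (LinearMap.snd R P P2 ∘ₗ (LinearMap.ker π).subtype) (by
        rintro ⟨⟨p, q⟩, hx⟩
        rw [LinearMap.mem_ker] at hx ⊢
        change g2 q = 0
        have := congrArg b hx
        rwa [hπa, map_add, hba, hsl', zero_add, map_zero] at this)
    have huv : Ses u v := by
      refine ⟨?_, ?_, ?_⟩
      · intro x y hxy
        have := congrArg (fun z : LinearMap.ker π => z.1.1) hxy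
        exact hs.inj this
      · rintro ⟨q, hq⟩
        have h1 : b (- s q) = 0 := by rw [map_neg, hsl', LinearMap.mem_ker.1 hq, neg_zero]
        obtain ⟨x, hx⟩ := (h.exact _).1 h1
        obtain ⟨p, rfl⟩ := hs.surj x
        exact ⟨⟨(p, q), by rw [LinearMap.mem_ker, hπa, hx, neg_add_cancel]⟩, rfl⟩
      · rintro ⟨⟨p, q⟩, hx⟩
        constructor
        · intro hq
          have hq0 : q = 0 := congrArg Subtype.val hq
          subst hq0
          rw [LinearMap.mem_ker, hπa, map_zero, add_zero, map_eq_zero_iff a h.inj] at hx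
          obtain ⟨x, rfl⟩ := (hs.exact p).1 hx
          exact ⟨x, rfl⟩
        · rintro ⟨x, hx'⟩
          have : (0 : P2) = q := congrArg (fun z : LinearMap.ker π => z.1.2) hx'
          exact Subtype.ext this.symm
    obtain ⟨KI, K'', f', g', h1, h2, h3⟩ := ih (N := N') (I := ModuleCat.of R (LinearMap.ker π))
      (N'' := ModuleCat.of R (LinearMap.ker g2)) (a := u) (b := v) huv hK
    exact ⟨KI, K'', f', g', ⟨_, ModuleCat.of R (P × P2), _, π,
      inferInstanceAs (Module.Projective R (P × P2)), ses_ker hπ, h1⟩,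
      ⟨_, P2, _, g2, hP2, ses_ker hs2.surj, h2⟩, h3⟩

lemma gfdLE_of_syz (hproj : ∀ P : ModuleCat.{0} R, Module.Projective R P → IsGFlat R P) (n : ℕ) :
    ∀ M : ModuleCat.{0} R, (∀ K, Syz n M K → IsGFlat R K) → gfdLE R n M := by
  induction n with
  | zero => exact fun M H => H M rfl
  | succ n ih =>
    intro M H
    obtain ⟨P, K, f, g, hP, h⟩ := exists_cover (R := R) M
    exact ⟨K, P, f, g, hproj P hP, h.inj, h.surj, h.exact,
      ih K fun L hL => H L ⟨K, P, f, g, hP, h, hL⟩⟩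

lemma gfdLE_of_ev (n : ℕ) (H : ∀ I : ModuleCat.{0} R, Module.Injective R I →
      ∀ M : ModuleCat.{0} R, EV R (n+1) M (CharacterModule I)) (M : ModuleCat.{0} R) :
    gfdLE R n M := by
  have key : ∀ K : ModuleCat.{0} R, (∃ N, Syz n N K) → IsGFlat R K := by
    refine isGFlat_of_class (fun K => ∃ N, Syz n N K) ?_ ?_ ?_
    · rintro K ⟨N, hN⟩
      obtain ⟨P, L, f, g, hP, h⟩ := exists_cover (R := R) K
      obtain ⟨N', _, _, _, _, _, hN'⟩ := hN.append n hP h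
      exact ⟨L, P, f, g, ⟨N', hN'⟩, inferInstance, h⟩
    · rintro K ⟨N, hN⟩
      obtain ⟨I, N'', a, b, hI, h⟩ := exists_emb (R := R) N
      obtain ⟨KI, K'', f, g, h1, h2, h3⟩ := horseshoe n h hN
      exact ⟨K'', KI, f, g, ⟨N'', h2⟩, flat_of_syz n I KI (H I hI) h1, h3⟩
    · rintro K ⟨N, hN⟩ I hI
      exact ev_syz n N K hN (H I hI N)
  exact gfdLE_of_syz (fun P hP => key P (syz_proj n P hP)) n M fun K hK => key K ⟨M, hK⟩

lemma ev_of_gfdLE (n : ℕ) : ∀ (M : ModuleCat.{0} R), gfdLE R n M → ∀ I : ModuleCat.{0} R,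
    Module.Injective R I → ∀ j, EV R (n + j + 1) M (CharacterModule I) := by
  induction n with
  | zero => exact fun M h I hI j => ev_of_gflat h I hI _
  | succ n ih =>
    rintro M ⟨K, G, f, g, hG, h1, h2, h3, hK⟩ I hI j
    have hs : Ses f g := ⟨h1, h2, h3⟩
    have e : n + 1 + j + 1 = (n + j + 1) + 1 := by omega
    rw [e]
    exact hs.ev_third (ih K hK I hI j) (ev_of_gflat hG I hI _)

lemma ev_of_gpdLE (n : ℕ) : ∀ (M : ModuleCat.{0} R), gpdLE R n M →
    ∀ j, EV R (n + j + 1) M R := by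
  induction n with
  | zero => exact fun M h j => ev_of_gproj h _
  | succ n ih =>
    rintro M ⟨K, G, f, g, hG, h1, h2, h3, hK⟩ j
    have hs : Ses f g := ⟨h1, h2, h3⟩
    have e : n + 1 + j + 1 = (n + j + 1) + 1 := by omega
    rw [e]
    exact hs.ev_third (ih K hK j) (ev_of_gproj hG _)

end syz

section gp

variable {R : Type} [CommRing R]

/-- finitely presented modules with vanishing `Ext(-, R)`. -/
def GC (K : ModuleCat.{0} R) : Prop := Module.FinitePresentation R K ∧ ∀ i, EV R (i+1) K R

lemma gc_left (hR : IsCoherentRing R) (K : ModuleCat.{0} R) (hK : GC K) :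
    ∃ (k : ℕ) (L : ModuleCat.{0} R) (f : L →ₗ[R] (Fin k → R)) (g : (Fin k → R) →ₗ[R] K),
      GC L ∧ Ses f g := by
  obtain ⟨k, L, f, g, hL, h⟩ := cover_fp hR K hK.1
  exact ⟨k, L, f, g, ⟨hL, fun i => h.ev_first (ev_proj inferInstance _) (hK.2 _)⟩, h⟩

lemma gc_flat (hR : IsCoherentRing R) {X : Type} [AddCommGroup X] [Module R X]
    (hX : Module.Flat R X) (i : ℕ) : ∀ (K : ModuleCat.{0} R), GC K → EV R (i+1) K X := by
  induction i with
  | zero =>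
    intro K hK
    obtain ⟨k, L, f, g, hL, h⟩ := gc_left hR K hK
    refine h.ev_one_of_extend (ev_proj inferInstance 0) fun φ => ?_
    have := hL.1
    obtain ⟨m, u, v, huv⟩ := Module.Flat.exists_factorization_of_finitePresentation φ
    choose ψ hψ using fun j : Fin m => h.extend (hK.2 0) (Finsupp.lapply j ∘ₗ u)
    refine ⟨v ∘ₗ (Finsupp.linearEquivFunOnFinite R R (Fin m)).symm.toLinearMap ∘ₗ LinearMap.pi ψ, ?_⟩
    rw [huv]
    ext x
    have : (Finsupp.linearEquivFunOnFinite R R (Fin m)).symm (fun j => ψ j (f x)) = u x := by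
      rw [LinearEquiv.symm_apply_eq]
      ext j
      exact LinearMap.congr_fun (hψ j) x
    have h2 := congrArg v this
    exact h2
  | succ i ih =>
    intro K hK
    obtain ⟨k, L, f, g, hL, h⟩ := gc_left hR K hK
    exact h.ev_third (ih L hL) (ev_proj inferInstance _)

lemma gc_ev (hR : IsCoherentRing R) (n : ℕ) : ∀ (X : ModuleCat.{0} R),
    (∀ M : ModuleCat.{0} R, EV R (n+1) M (CharacterModule X)) →
    ∀ (K : ModuleCat.{0} R), GC K → ∀ i, EV R (i+1) K X := by
  induction n with
  | zero =>
    intro X H K hK i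
    exact gc_flat hR (flat_of_ev_fp fun M _ => H M) i K hK
  | succ n ih =>
    intro X H K hK i
    obtain ⟨P, Ω, f, g, hP, h⟩ := exists_cover (R := R) X
    have hPi : Module.Injective R (CharacterModule P) := flat_iff_dual_inj.1 inferInstance
    exact h.ev_co_third (gc_flat hR inferInstance i K hK)
      (ih Ω (fun M => h.dual.ev_co_third (ev_inj hPi _) (H M)) K hK (i+1))

lemma gc_sep (hR : IsCoherentRing R) (n : ℕ) (H : ∀ I : ModuleCat.{0} R, Module.Injective R I →
      ∀ M : ModuleCat.{0} R, EV R (n+1) M (CharacterModule I))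
    (K : ModuleCat.{0} R) (hK : GC K) (x : K) (hx : ∀ φ : K →ₗ[R] R, φ x = 0) : x = 0 := by
  obtain ⟨I, _, a, _, hI, ha⟩ := exists_emb (R := R) K
  obtain ⟨P, Ω, f, g, hP, h⟩ := exists_cover (R := R) I
  have hPi : Module.Injective R (CharacterModule P) := flat_iff_dual_inj.1 inferInstance
  have hΩ : ∀ M : ModuleCat.{0} R, EV R (n+1) M (CharacterModule Ω) := by
    intro M
    refine h.dual.ev_co_third (ev_inj hPi _) ?_
    obtain ⟨P', L, f', g', hP', h'⟩ := exists_cover (R := R) M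
    exact h'.ev_third (H I hI L) (ev_proj hP' _)
  obtain ⟨ψ, hψ⟩ := h.lift (gc_ev hR n Ω hΩ K hK 0) a
  have h0 : ψ x = 0 := by
    rw [← Module.forall_dual_apply_eq_zero_iff R]
    intro φ
    exact hx (φ ∘ₗ ψ)
  apply ha.inj
  rw [← hψ, LinearMap.comp_apply, h0, map_zero, map_zero]

lemma dual_fg (hR : IsCoherentRing R) (K : ModuleCat.{0} R) (hK : Module.FinitePresentation R K) :
    Module.Finite R (K →ₗ[R] R) := by
  obtain ⟨k, L, f, g, hL, h⟩ := cover_fp hR K hK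
  obtain ⟨m, q, hq⟩ := Module.Finite.exists_fin' R L
  let S : ((Fin k → R) →ₗ[R] R) →ₗ[R] (Fin m → R) :=
    LinearMap.pi fun j => LinearMap.applyₗ (f (q (Pi.single j 1)))
  have hS : ∀ u j, S u j = u (f (q (Pi.single j 1))) := fun u j => rfl
  have : Module.Finite R ((Fin k → R) →ₗ[R] R) := inferInstance
  have hfp : Module.FinitePresentation R (LinearMap.range S) := fp_sub hR m _ (Submodule.FG.of_finite)
  have hk : (LinearMap.ker S.rangeRestrict).FG :=
    Module.FinitePresentation.fg_ker S.rangeRestrict S.surjective_rangeRestrict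
  rw [LinearMap.ker_rangeRestrict] at hk
  let T : (K →ₗ[R] R) →ₗ[R] ((Fin k → R) →ₗ[R] R) := LinearMap.lcomp R R g
  have hT : Function.Injective T := by
    intro u v huv
    exact (LinearMap.cancel_right h.surj).1 huv
  have hr : LinearMap.range T = LinearMap.ker S := by
    ext u
    constructor
    · rintro ⟨v, rfl⟩
      rw [LinearMap.mem_ker]
      ext j
      rw [hS]
      change v (g (f _)) = 0
      rw [h.exact.apply_apply_eq_zero, map_zero]
    · intro hu
      rw [LinearMap.mem_ker] at hu
      have : u ∘ₗ f = 0 := by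
        rw [← LinearMap.cancel_right hq]
        refine LinearMap.pi_ext' fun j => ?_
        ext
        exact congrFun hu j
      obtain ⟨v, hv⟩ := h.factor u this
      exact ⟨v, hv⟩
  rw [← hr] at hk
  have : Module.Finite R (LinearMap.range T) := .of_fg hk
  exact Module.Finite.equiv (LinearEquiv.ofInjective T hT).symm

lemma gc_right (hR : IsCoherentRing R) (n : ℕ) (H : ∀ I : ModuleCat.{0} R, Module.Injective R I →
      ∀ M : ModuleCat.{0} R, EV R (n+1) M (CharacterModule I))
    (K : ModuleCat.{0} R) (hK : GC K) :
    ∃ (k : ℕ) (L : ModuleCat.{0} R) (f : K →ₗ[R] (Fin k → R)) (g : (Fin k → R) →ₗ[R] L),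
      GC L ∧ Ses f g := by
  have := dual_fg hR K hK.1
  obtain ⟨k, G, hG⟩ := Module.Finite.exists_fin' R (K →ₗ[R] R)
  let ι : K →ₗ[R] (Fin k → R) := LinearMap.pi fun j => G (Pi.single j 1)
  have hext : ∀ φ : K →ₗ[R] R, ∃ ψ : (Fin k → R) →ₗ[R] R, ψ ∘ₗ ι = φ := by
    intro φ
    obtain ⟨c, rfl⟩ := hG φ
    refine ⟨∑ j, c j • LinearMap.proj j, ?_⟩
    conv_rhs => rw [pi_eq_sum_univ' c]
    ext x
    simp [ι, LinearMap.sum_apply]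
  have hι : Function.Injective ι := by
    rw [injective_iff_map_eq_zero]
    intro x hx
    refine gc_sep hR n H K hK x fun φ => ?_
    obtain ⟨ψ, rfl⟩ := hext φ
    rw [LinearMap.comp_apply, hx, map_zero]
  have hs := ses_quot hι
  have := hK.1
  refine ⟨k, ModuleCat.of R ((Fin k → R) ⧸ LinearMap.range ι), ι, _, ⟨?_, ?_⟩, hs⟩
  · exact Module.finitePresentation_of_surjective (LinearMap.range ι).mkQ (Submodule.mkQ_surjective _)
      (by rw [Submodule.ker_mkQ]; exact Submodule.FG.of_finite)
  · intro i
    cases i with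
    | zero => exact hs.ev_one_of_extend (ev_proj inferInstance 0) hext
    | succ i => exact hs.ev_third (hK.2 i) (ev_proj inferInstance _)

lemma gpdLE_of_ev (hR : IsCoherentRing R) (m : ℕ) (H : ∀ I : ModuleCat.{0} R, Module.Injective R I →
      ∀ M : ModuleCat.{0} R, EV R (m+1) M (CharacterModule I)) (n : ℕ) :
    ∀ (M : ModuleCat.{0} R), Module.FinitePresentation R M → (∀ i, EV R (n+i+1) M R) →
      gpdLE R n M := by
  have key : ∀ K : ModuleCat.{0} R, GC K → IsGProj R K := by
    refine isGProj_of_class GC ?_ ?_ ?_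
    · intro K hK
      obtain ⟨k, L, f, g, hL, h⟩ := gc_left hR K hK
      exact ⟨L, ModuleCat.of R (Fin k → R), f, g, hL,
        inferInstanceAs (Module.Projective R (Fin k → R)), h⟩
    · intro K hK
      obtain ⟨k, L, f, g, hL, h⟩ := gc_right hR m H K hK
      exact ⟨L, ModuleCat.of R (Fin k → R), f, g, hL,
        inferInstanceAs (Module.Projective R (Fin k → R)), h⟩
    · intro K hK Q hQ
      exact gc_flat hR inferInstance 0 K hK
  induction n with
  | zero =>
    intro M hM h
    exact key M ⟨hM, fun i => by simpa using h i⟩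
  | succ n ih =>
    intro M hM h
    obtain ⟨k, L, f, g, hL, hs⟩ := cover_fp hR M hM
    refine ⟨L, ModuleCat.of R (Fin k → R), f, g, key _ ⟨?_, ?_⟩, hs.inj, hs.surj, hs.exact,
      ih L hL fun i => ?_⟩
    · exact Module.finitePresentation_of_projective R (Fin k → R)
    · exact fun i => ev_proj (inferInstanceAs (Module.Projective R (Fin k → R))) i
    · refine hs.ev_first (ev_proj inferInstance _) ?_
      have := h i
      rwa [show n + 1 + i + 1 = n + i + 1 + 1 by omega] at this

lemma exists_of_iInf_le {p : ℕ → Prop} {n : ℕ} (h : (⨅ (m : ℕ) (_ : p m), (m : ℕ∞)) ≤ n) :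
    ∃ m ≤ n, p m := by
  by_contra! hc
  have : ((n + 1 : ℕ) : ℕ∞) ≤ ⨅ (m : ℕ) (_ : p m), (m : ℕ∞) := by
    refine le_iInf₂ fun m hm => ?_
    rw [Nat.cast_le]
    by_contra! hlt
    exact hc m (by omega) hm
  have := this.trans h
  rw [Nat.cast_le] at this
  omega

lemma main_iff (hR : IsCoherentRing R) (n : ℕ) : gwdim R ≤ n ↔
    (⨆ (M : ModuleCat.{0} R) (_ : Module.FinitePresentation R M), gpd R M) ≤ n := by
  rw [gwdim, iSup_le_iff, iSup₂_le_iff]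
  constructor
  · intro h M hM
    have H : ∀ I : ModuleCat.{0} R, Module.Injective R I →
        ∀ M : ModuleCat.{0} R, EV R (n+1) M (CharacterModule I) := by
      intro I hI M
      obtain ⟨m, hm, hM⟩ := exists_of_iInf_le (h M)
      obtain ⟨j, rfl⟩ := Nat.exists_eq_add_of_le hm
      exact ev_of_gfdLE m M hM I hI j
    have H2 : ∀ M : ModuleCat.{0} R, Module.FinitePresentation R M → EV R (n+1) M R :=
      fun M hM => (ev_fp_iff hR n M hM).2 fun I hI => H I hI M
    exact iInf₂_le n (gpdLE_of_ev hR n H n M hM fun i => ev_mono hR (Nat.le_add_right n i) H2 M hM)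
  · intro h M
    have H2 : ∀ M : ModuleCat.{0} R, Module.FinitePresentation R M → EV R (n+1) M R := by
      intro M hM
      obtain ⟨m, hm, hM⟩ := exists_of_iInf_le (h M hM)
      obtain ⟨j, rfl⟩ := Nat.exists_eq_add_of_le hm
      exact ev_of_gpdLE m M hM j
    refine iInf₂_le n (gfdLE_of_ev n (fun I hI => ?_) M)
    exact ev_all_of_fp n fun N hN => (ev_fp_iff hR n N hN).1 (H2 N hN) I hI

end gp
end GW

/-- for a coherent ring `R`, the Gorenstein weak dimension equals the
supremum of Gorenstein projective dimensions of finitely presented modules. -/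
theorem stmt10 (R : Type) [CommRing R] (hR : GW.IsCoherentRing R) :
    GW.gwdim R =
      ⨆ (M : ModuleCat.{0} R) (_ : Module.FinitePresentation R M), GW.gpd R M := by
  refine eq_of_forall_ge_iff fun c => ?_
  induction c using ENat.recTopCoe with
  | top => simp
  | coe n => exact GW.main_iff hR n
end
end

section
/- There exists a commutative ring S with Gorenstein weak dimension equal to 1 that is not an arithmetical ring; namely S = R[[X]] for (R, m) a local quasi-Frobenius ring that is not a field. -/
open CategoryTheory

noncomputable section

/-- The properties asked of `R` in STATEMENT 16: `R` is local quasi-Frobenius, not a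
field, and `S = R[[X]]` has Gorenstein weak dimension `1` but is not arithmetical. -/
def Stmt16Witness (R : Type) [CommRing R] : Prop :=
  IsLocalRing R ∧ GW.IsQuasiFrobenius R ∧ ¬ IsField R ∧
  GW.gwdim (PowerSeries R) = 1 ∧ ¬ GW.IsArithmetical (PowerSeries R)

section Helpers

open TensorProduct

section Abs

variable {A S : Type} [CommRing A] [CommRing S] [Algebra A S]

lemma add_self_zero_of_two {S N : Type} [CommRing S] [AddCommGroup N] [Module S N]
    (h2 : (2 : S) = 0) (x : N) : x + x = 0 := by
  rw [← two_smul S x, h2, zero_smul]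

lemma exists_iota {K : Type} [AddCommGroup K] [Module S K] [Module A K] [IsScalarTower A S K]
    (e : S) (he : e * e = 0) (p q : S →ₗ[A] A)
    (hs : ∀ s, s = algebraMap A S (q s) + e * algebraMap A S (p s)) :
    ∃ ι : K →ₗ[S] S ⊗[A] K, ∀ x, ι x = e ⊗ₜ[A] x + 1 ⊗ₜ[A] (e • x) := by
  have hA : ∀ (a : A) (x : K), e ⊗ₜ[A] (algebraMap A S a • x) +
      (1 : S) ⊗ₜ[A] (e • algebraMap A S a • x) =
      algebraMap A S a • (e ⊗ₜ[A] x + (1 : S) ⊗ₜ[A] (e • x)) := by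
    intro a x
    rw [smul_comm e, algebraMap_smul, algebraMap_smul, algebraMap_smul, tmul_smul, tmul_smul,
      smul_add]
  have hE : ∀ x : K, e ⊗ₜ[A] (e • x) + (1 : S) ⊗ₜ[A] (e • e • x) =
      e • (e ⊗ₜ[A] x + (1 : S) ⊗ₜ[A] (e • x)) := by
    intro x
    rw [smul_smul, he, zero_smul, tmul_zero, add_zero, smul_add, smul_tmul', smul_tmul',
      smul_eq_mul, he, zero_tmul, zero_add, smul_eq_mul, mul_one]
  refine ⟨{ toFun := fun x => e ⊗ₜ[A] x + 1 ⊗ₜ[A] (e • x), map_add' := ?_, map_smul' := ?_ },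
    fun x => rfl⟩
  · intro x y
    simp only [tmul_add, smul_add]
    abel
  · intro s x
    simp only [RingHom.id_apply]
    rw [hs s, add_smul, mul_smul, smul_add e, tmul_add, tmul_add, add_smul, mul_smul, ← hA, ← hA,
      ← hE]
    exact add_add_add_comm _ _ _ _

lemma exact_lTensor {K I : Type} [AddCommGroup K] [Module S K] [Module A K] [IsScalarTower A S K]
    [AddCommGroup I] [Module S I] [Module A I] [IsScalarTower A S I]
    (e : S) (h2 : (2 : S) = 0)
    (d : S ⊗[A] K →ₗ[S] S ⊗[A] K) (hd : ∀ x : K, d (1 ⊗ₜ x) = e ⊗ₜ[A] x + 1 ⊗ₜ[A] (e • x))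
    (hdd : ∀ z, d (d z) = 0)
    (t : I →ₗ[A] I) (ht : ∀ x, e • t x + t (e • x) = x) :
    Function.Exact (LinearMap.lTensor I d) (LinearMap.lTensor I d) := by
  let Φ := AlgebraTensorModule.cancelBaseChange A S S I K
  have key : ∀ w : I ⊗[A] K, Φ (LinearMap.lTensor I d (Φ.symm (LinearMap.rTensor K t w))) +
      LinearMap.rTensor K t (Φ (LinearMap.lTensor I d (Φ.symm w))) = w := by
    intro w
    induction w with
    | zero => simp
    | add x y hx hy =>
      simp only [map_add]
      rw [add_add_add_comm, hx, hy]
    | tmul m k =>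
      simp only [Φ, LinearMap.rTensor_tmul, AlgebraTensorModule.cancelBaseChange_symm_tmul,
        LinearMap.lTensor_tmul, hd, tmul_add, map_add,
        AlgebraTensorModule.cancelBaseChange_tmul, one_smul]
      have := add_self_zero_of_two h2 (t m ⊗ₜ[A] (e • k))
      rw [add_add_add_comm, this, add_zero, ← add_tmul, ht]
  intro z
  constructor
  · intro hz
    refine ⟨Φ.symm (LinearMap.rTensor K t (Φ z)), ?_⟩
    have := key (Φ z)
    rw [LinearEquiv.symm_apply_apply, hz, map_zero, map_zero, add_zero] at this
    exact Φ.injective this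
  · rintro ⟨y, rfl⟩
    rw [← LinearMap.comp_apply, ← LinearMap.lTensor_comp]
    have : d ∘ₗ d = 0 := LinearMap.ext hdd
    rw [this]
    simp

theorem isGFlat_of_flat {K : Type} [AddCommGroup K] [Module S K] [Module A K]
    [IsScalarTower A S K] [Module.Flat A K]
    (e : S) (he : e * e = 0) (h2 : (2 : S) = 0) (p q : S →ₗ[A] A)
    (hs : ∀ s, s = algebraMap A S (q s) + e * algebraMap A S (p s))
    (hp1 : p 1 = 0) (hpe : p e = 1) : GW.IsGFlat S (ModuleCat.of S K) := by
  obtain ⟨ι, hι⟩ := exists_iota (K := K) e he p q hs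
  let μ : S ⊗[A] K →ₗ[S] K := LinearMap.liftBaseChange S (LinearMap.id (R := A) (M := K))
  let P : S ⊗[A] K →ₗ[A] K :=
    (TensorProduct.lid A K).toLinearMap ∘ₗ LinearMap.rTensor K p
  have hP : ∀ x, P (ι x) = x := by
    intro x
    simp [P, hι, hp1, hpe]
  have hinj : Function.Injective ι := Function.LeftInverse.injective hP
  have hμ1 : ∀ x, μ (1 ⊗ₜ x) = x := by intro x; simp [μ]
  have hμι : ∀ x, μ (ι x) = 0 := by
    intro x
    simp only [hι, μ, map_add, LinearMap.liftBaseChange_tmul, LinearMap.id_apply, one_smul]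
    exact add_self_zero_of_two h2 _
  have hdec : ∀ z, z = ι (P z) + 1 ⊗ₜ[A] μ z := by
    intro z
    induction z with
    | zero => simp
    | add x y hx hy =>
      conv_lhs => rw [hx, hy]
      simp only [map_add, tmul_add]
      exact add_add_add_comm _ _ _ _
    | tmul s x =>
      have h0 := add_self_zero_of_two h2 ((1 : S) ⊗ₜ[A] (e • p s • x))
      simp only [P, μ, hι, LinearMap.liftBaseChange_tmul, LinearMap.id_apply,
        LinearMap.comp_apply, LinearMap.rTensor_tmul, LinearEquiv.coe_coe, lid_tmul]
      conv_lhs => rw [hs s]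
      have h3 : s • x = q s • x + e • p s • x := by
        conv_lhs => rw [hs s]
        rw [add_smul, mul_smul, algebraMap_smul, algebraMap_smul]
      rw [h3, tmul_add, add_tmul]
      have h4 : (algebraMap A S (q s)) ⊗ₜ[A] x = (1 : S) ⊗ₜ[A] (q s • x) := by
        rw [Algebra.algebraMap_eq_smul_one, smul_tmul]
      have h5 : (e * algebraMap A S (p s)) ⊗ₜ[A] x = e ⊗ₜ[A] (p s • x) := by
        rw [mul_comm, ← Algebra.smul_def, smul_tmul]
      rw [h4, h5]
      rw [add_add_add_comm, add_comm ((1 : S) ⊗ₜ[A] (e • p s • x)), add_assoc, h0,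
        add_zero, add_comm]
  let d : S ⊗[A] K →ₗ[S] S ⊗[A] K := ι ∘ₗ μ
  have hd : ∀ x : K, d (1 ⊗ₜ x) = e ⊗ₜ[A] x + 1 ⊗ₜ[A] (e • x) := by
    intro x
    simp only [d, LinearMap.comp_apply, hμ1, hι]
  have hdd : ∀ z, d (d z) = 0 := by
    intro z
    simp only [d, LinearMap.comp_apply, hμι, map_zero]
  have hker : LinearMap.range ι = LinearMap.ker d := by
    ext z
    constructor
    · rintro ⟨x, rfl⟩
      simp [d, hμι]
    · intro hz
      have : μ z = 0 := hinj (by simpa [d] using hz)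
      have h := hdec z
      rw [this, tmul_zero, add_zero] at h
      exact ⟨_, h.symm⟩
  refine ⟨fun _ => ModuleCat.of S (S ⊗[A] K), fun _ => d, ?_, ?_, ?_, ?_⟩
  · intro i
    exact Module.Flat.baseChange A S K
  · intro i z
    constructor
    · intro hz
      have : z ∈ LinearMap.range ι := by rw [hker]; exact hz
      obtain ⟨x, rfl⟩ := this
      exact ⟨(1 : S) ⊗ₜ[A] x, by rw [hd, hι]⟩
    · rintro ⟨y, rfl⟩
      exact hdd y
  · intro I hI i
    let : Module A I := Module.compHom I (algebraMap A S)
    have : IsScalarTower A S I := ⟨fun a s x => by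
      rw [Algebra.smul_def, mul_smul]; rfl⟩
    obtain ⟨j, hj⟩ := exists_iota (K := I) e he p q hs
    have hjinj : Function.Injective j := by
      refine Function.LeftInverse.injective
        (g := (TensorProduct.lid A I).toLinearMap ∘ₗ LinearMap.rTensor I p) ?_
      intro x
      simp [hj, hp1, hpe]
    obtain ⟨r, hr⟩ := hI.out j hjinj LinearMap.id
    let t : I →ₗ[A] I := r.restrictScalars A ∘ₗ TensorProduct.mk A S I 1
    refine exact_lTensor e h2 d hd hdd t ?_
    intro x
    have h := hr x
    rw [hj, map_add, LinearMap.id_apply] at h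
    conv_rhs => rw [← h]
    simp only [t, LinearMap.comp_apply, LinearMap.restrictScalars_apply, mk_apply]
    rw [← map_smul, smul_tmul', smul_eq_mul, mul_one]
  · exact ⟨(LinearEquiv.ofInjective ι hinj).trans (LinearEquiv.ofEq _ _ hker)⟩

theorem gfdLE_one [IsDomain A] [IsPrincipalIdealRing A]
    (e : S) (he : e * e = 0) (h2 : (2 : S) = 0) (p q : S →ₗ[A] A)
    (hs : ∀ s, s = algebraMap A S (q s) + e * algebraMap A S (p s))
    (hp1 : p 1 = 0) (hpe : p e = 1) (M : ModuleCat.{0} S) : GW.gfdLE S 1 M := by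
  have hS : ∀ (a : A) (s : S), a ≠ 0 → a • s = 0 → s = 0 := by
    intro a s ha h
    have h1 : p s = 0 := by
      have := congrArg p h
      simpa [ha] using this
    have h0 : q s = 0 := by
      have := congrArg q h
      simpa [ha] using this
    rw [hs s, h1, h0]
    simp
  have hG : ∀ N : Submodule S (M →₀ S), Module.Flat A N := by
    intro N
    have : Module.IsTorsionFree A N := by
      refine (Module.isTorsionFree_iff_smul_eq_zero (R := A) (M := N)).2 ?_
      intro a x h
      by_contra! hc
      apply hc.2
      ext m
      have := DFunLike.congr_fun (congrArg Subtype.val h) m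
      exact hS a _ hc.1 (by simpa using this)
    have hD : IsDedekindDomain A := inferInstance
    exact (IsDedekindDomain.flat_iff_torsion_eq_bot (R := A) (M := N)).2
      ((Submodule.isTorsionFree_iff_torsion_eq_bot (R := A) (M := N)).1 this)
  let g : (M →₀ S) →ₗ[S] M := Finsupp.linearCombination S id
  refine ⟨ModuleCat.of S (LinearMap.ker g), ModuleCat.of S (⊤ : Submodule S (M →₀ S)),
    Submodule.inclusion le_top, g ∘ₗ Submodule.subtype _, ?_, ?_, ?_, ?_, ?_⟩
  · have := hG ⊤
    exact isGFlat_of_flat (A := A) e he h2 p q hs hp1 hpe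
  · exact Submodule.inclusion_injective _
  · intro m
    exact ⟨⟨Finsupp.single m 1, trivial⟩, by simp [g]⟩
  · intro x
    constructor
    · intro h
      exact ⟨⟨x.1, h⟩, rfl⟩
    · rintro ⟨y, rfl⟩
      exact y.2
  · have := hG (LinearMap.ker g)
    exact isGFlat_of_flat (A := A) e he h2 p q hs hp1 hpe

theorem gwdim_eq_one [IsDomain A] [IsPrincipalIdealRing A]
    (e : S) (he : e * e = 0) (h2 : (2 : S) = 0) (p q : S →ₗ[A] A)
    (hs : ∀ s, s = algebraMap A S (q s) + e * algebraMap A S (p s))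
    (hp1 : p 1 = 0) (hpe : p e = 1) (x : S) (hx : x ∈ nonZeroDivisors S) (hxu : ¬ IsUnit x) :
    GW.gwdim S = 1 := by
  apply le_antisymm
  · refine iSup_le fun M => ?_
    exact iInf₂_le_of_le 1 (gfdLE_one (A := A) e he h2 p q hs hp1 hpe M) (by simp)
  · refine le_trans ?_ (le_iSup _ (ModuleCat.of S (S ⧸ Ideal.span {x})))
    refine le_iInf₂ fun n hn => ?_
    rcases n with _ | n
    · exfalso
      obtain ⟨F, d, hF, -, -, ⟨φ⟩⟩ := hn
      apply hxu
      rw [← Ideal.span_singleton_eq_top, Ideal.eq_top_iff_one]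
      have hreg : ∀ y : F 0, x • y = 0 → y = 0 := by
        intro y hy
        have := hF 0
        have h := Module.Flat.isSMulRegular_of_nonZeroDivisors (M := F 0) hx
        exact h (by simpa using hy)
      have h1 : x • (Ideal.Quotient.mk (Ideal.span {x}) 1 : S ⧸ Ideal.span {x}) = 0 := by
        change Ideal.Quotient.mk (Ideal.span {x}) (x * 1) = 0
        rw [Ideal.Quotient.eq_zero_iff_mem, mul_one]
        exact Ideal.mem_span_singleton_self x
      have h3 := congrArg Subtype.val ((map_smul φ x _).symm.trans ((congrArg φ h1).trans (map_zero φ)))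
      have h4 := hreg _ h3
      have h5 := φ.injective ((Subtype.ext h4).trans (map_zero φ).symm)
      exact Ideal.Quotient.eq_zero_iff_mem.mp h5
    · simp

end Abs

section Concrete

open PowerSeries

abbrev kk : Type := ZMod 2

abbrev RR : Type := DualNumber kk

abbrev eS : PowerSeries RR := PowerSeries.C (DualNumber.eps : RR)

lemma smul_def' (a : PowerSeries kk) (f : PowerSeries RR) :
    a • f = PowerSeries.map (algebraMap kk RR) a * f := rfl

def pS : PowerSeries RR →ₗ[PowerSeries kk] PowerSeries kk where
  toFun f := PowerSeries.mk fun n => TrivSqZeroExt.snd (PowerSeries.coeff n f)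
  map_add' f g := by ext n; simp
  map_smul' a f := by
    ext n
    simp only [smul_def', coeff_mk, coeff_mul, RingHom.id_apply, smul_eq_mul, coeff_map,
      TrivSqZeroExt.snd_sum]
    refine Finset.sum_congr rfl fun i _ => ?_
    simp [TrivSqZeroExt.algebraMap_eq_inl]

def rS : PowerSeries RR →+* PowerSeries kk :=
  PowerSeries.map (TrivSqZeroExt.fstHom kk kk kk).toRingHom

def qS : PowerSeries RR →ₗ[PowerSeries kk] PowerSeries kk where
  toFun f := rS f
  map_add' f g := by simp
  map_smul' a f := by
    rw [smul_def', map_mul]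
    congr 1

lemma hsS (s : PowerSeries RR) : s = algebraMap (PowerSeries kk) (PowerSeries RR) (qS s) +
    eS * algebraMap (PowerSeries kk) (PowerSeries RR) (pS s) := by
  change s = PowerSeries.map (algebraMap kk RR) (qS s) +
    eS * PowerSeries.map (algebraMap kk RR) (pS s)
  ext n
  · simp [qS, pS, rS, TrivSqZeroExt.algebraMap_eq_inl]
  · simp [qS, pS, rS, TrivSqZeroExt.algebraMap_eq_inl]

lemma heS : eS * eS = 0 := by
  rw [eS, ← map_mul, DualNumber.eps_mul_eps, map_zero]

lemma h2R : (2 : RR) = 0 := by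
  have : (2 : RR) = algebraMap kk RR 2 := (map_ofNat (algebraMap kk RR) 2).symm
  rw [this, show (2 : kk) = 0 from rfl, map_zero]

lemma h2S : (2 : PowerSeries RR) = 0 := by
  have : (2 : PowerSeries RR) = PowerSeries.C (2 : RR) :=
    (map_ofNat (PowerSeries.C (R := RR)) 2).symm
  rw [this, h2R, map_zero]

lemma hp1S : pS 1 = 0 := by
  ext n
  simp only [pS, LinearMap.coe_mk, AddHom.coe_mk, coeff_mk, coeff_one, map_zero]
  split_ifs <;> simp

lemma hpeS : pS eS = 1 := by
  ext n
  simp only [pS, LinearMap.coe_mk, AddHom.coe_mk, coeff_mk, coeff_one, coeff_C]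
  split_ifs <;> simp

lemma gwdim_RR : GW.gwdim (PowerSeries RR) = 1 := by
  refine gwdim_eq_one (A := PowerSeries kk) eS heS h2S pS qS hsS hp1S hpeS PowerSeries.X ?_ ?_
  · rw [mem_nonZeroDivisors_iff_right]
    intro f hf
    ext1 n
    have := congrArg (PowerSeries.coeff (n + 1)) hf
    simpa using this
  · intro hu
    have := hu.map (PowerSeries.constantCoeff (R := RR))
    simp at this

lemma rr_injective : Module.Injective RR RR := by
  apply Module.Baer.injective
  intro I g
  rcases DualNumber.ideal_trichotomy I with rfl | rfl | rfl
  · refine ⟨0, fun x hx => ?_⟩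
    have : (⟨x, hx⟩ : (⊥ : Ideal RR)) = 0 := Subsingleton.elim _ _
    rw [this]
    simp
  · have hmem : (DualNumber.eps : RR) ∈ Ideal.span {(DualNumber.eps : RR)} :=
      Ideal.mem_span_singleton_self _
    have h0 : (DualNumber.eps : RR) * g ⟨_, hmem⟩ = 0 := by
      rw [← smul_eq_mul, ← map_smul]
      have : (DualNumber.eps : RR) • (⟨DualNumber.eps, hmem⟩ : Ideal.span {(DualNumber.eps : RR)})
          = 0 := by
        ext1
        exact DualNumber.eps_mul_eps
      rw [this, map_zero]
    have h1 : (g ⟨_, hmem⟩).fst = 0 := by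
      have := congrArg TrivSqZeroExt.snd h0
      simpa using this
    obtain ⟨c, hc⟩ := DualNumber.fst_eq_zero_iff_eps_dvd.1 h1
    refine ⟨LinearMap.mulRight RR c, fun x hx => ?_⟩
    obtain ⟨y, rfl⟩ := Ideal.mem_span_singleton'.1 hx
    have : (⟨y * DualNumber.eps, hx⟩ : Ideal.span {(DualNumber.eps : RR)}) =
      y • ⟨DualNumber.eps, hmem⟩ := rfl
    rw [this, map_smul, hc]
    simp [mul_assoc]
  · refine ⟨g ∘ₗ LinearMap.codRestrict ⊤ LinearMap.id (fun _ => trivial), fun x hx => rfl⟩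

lemma rr_not_field : ¬ IsField RR := by
  intro h
  have := h.isDomain
  have h1 : (DualNumber.eps : RR) = 0 := by
    have := DualNumber.eps_mul_eps (R := kk)
    simpa using mul_self_eq_zero.1 this
  have := congrArg TrivSqZeroExt.snd h1
  simp at this

lemma not_arith : ¬ GW.IsArithmetical (PowerSeries RR) := by
  intro h
  have hI := h (Ideal.span {PowerSeries.X, eS}) (Submodule.fg_span (by simp))
    (IsLocalRing.maximalIdeal _) inferInstance
  have hu : (IsLocalRing.maximalIdeal (PowerSeries RR)).primeCompl ≤
      IsUnit.submonoid (PowerSeries RR) := by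
    intro x hx
    by_contra hc
    exact hx hc
  let E := IsLocalization.atUnits (PowerSeries RR)
    (IsLocalRing.maximalIdeal (PowerSeries RR)).primeCompl
    (S := Localization.AtPrime (IsLocalRing.maximalIdeal (PowerSeries RR))) hu
  have h2 := hI.map_ringHom (E.symm : _ →+* PowerSeries RR)
  rw [Ideal.map_map] at h2
  have h3 : ((E.symm : _ →+* PowerSeries RR)).comp (algebraMap (PowerSeries RR)
      (Localization.AtPrime (IsLocalRing.maximalIdeal (PowerSeries RR)))) = RingHom.id _ := by
    ext1 x
    exact E.symm.commutes x
  rw [h3, Ideal.map_id] at h2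
  obtain ⟨g, hg⟩ := h2
  rw [Ideal.submodule_span_eq] at hg
  have hX : (PowerSeries.X : PowerSeries RR) ∈ Ideal.span {g} := by
    rw [← hg]; exact Ideal.subset_span (by simp)
  have he : eS ∈ Ideal.span {g} := by
    rw [← hg]; exact Ideal.subset_span (by simp)
  have hgm : g ∈ Ideal.span {PowerSeries.X, eS} := by
    rw [hg]; exact Ideal.mem_span_singleton_self g
  obtain ⟨u, hu'⟩ := Ideal.mem_span_singleton'.1 hX
  obtain ⟨v, hv⟩ := Ideal.mem_span_singleton'.1 he
  obtain ⟨a, b, hab⟩ := Ideal.mem_span_pair.1 hgm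
  have hrX : rS PowerSeries.X = PowerSeries.X := by simp [rS]
  have hre : rS eS = 0 := by simp [rS]
  have hg0 : rS g ≠ 0 := by
    intro hc
    have := congrArg rS hu'
    rw [map_mul, hc, mul_zero, hrX] at this
    exact PowerSeries.X_ne_zero this.symm
  have hv0 : rS v = 0 := by
    have := congrArg rS hv
    rw [map_mul, hre] at this
    exact (mul_eq_zero.1 this).resolve_right hg0
  have hgx : rS g = rS a * PowerSeries.X := by
    rw [← hab, map_add, map_mul, map_mul, hrX, hre, mul_zero, add_zero]
  have h5 : v * g = (pS v * rS g) • eS := by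
    conv_lhs => rw [hsS v, hsS g]
    change (algebraMap _ _ (rS v) + _) * (algebraMap _ _ (rS g) + _) = _
    rw [hv0, map_zero, zero_add, Algebra.smul_def, map_mul]
    linear_combination (algebraMap (PowerSeries kk) (PowerSeries RR) (pS v) *
      algebraMap (PowerSeries kk) (PowerSeries RR) (pS g)) * heS
  have h6 := congrArg pS (h5.symm.trans hv)
  rw [map_smul, hpeS, smul_eq_mul, mul_one, hgx] at h6
  have := congrArg (PowerSeries.constantCoeff) h6
  simp at this

end Concrete

end Helpers

/-- there exists a commutative ring `S` with Gorenstein weak dimension `1`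
which is not arithmetical, namely `S = R[[X]]` for `R` local quasi-Frobenius not a
field. -/
theorem stmt16 : ∃ (R : Type) (inst : CommRing R), @Stmt16Witness R inst := by
  refine ⟨RR, inferInstance, inferInstance, ⟨inferInstance, rr_injective⟩, rr_not_field,
    gwdim_RR, not_arith⟩
end
end
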